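/- arXiv:1404.6647 — 4 statements merged into one kernel-verified Lean document; each statement's English description precedes it below -/
import Mathlib

section
/- Let 𝔣 be an additive, κ-Lipschitz graph parameter that is invariant under graph isomorphism. Then for any n ≥ 1 and any two degree functions d, d' : {1,…,n} → ℕ, |E[𝔣(𝔾_d)]/n − E[𝔣(𝔾_{d'})]/n| ≤ 2κ·W((1/n)Σ_{i=1}^n δ_{d(i)}, (1/n)Σ_{i=1}^n δ_{d'(i)}), where W is the Wasserstein distance and δ_k is the Dirac mass at k. -/
open Finset Filter Topology MeasureTheory
open scoped Classical BigOperators ENNReal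

structure Multigraph where
  (V : Type)
  [fintypeV : Fintype V]
  (edges : Multiset (Sym2 V))

attribute [instance] Multigraph.fintypeV

def Multigraph.addEdge (G : Multigraph) (i j : G.V) : Multigraph :=
  { V := G.V, edges := s(i, j) ::ₘ G.edges }

def Multigraph.disjUnion (G₁ G₂ : Multigraph) : Multigraph :=
  { V := G₁.V ⊕ G₂.V,
    edges := G₁.edges.map (Sym2.map Sum.inl) + G₂.edges.map (Sym2.map Sum.inr) }

/-- A graph parameter is invariant under graph isomorphism. -/
def GraphParam.Invariant (f : Multigraph → ℝ) : Prop :=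
  ∀ (G₁ G₂ : Multigraph) (e : G₁.V ≃ G₂.V),
    G₂.edges = G₁.edges.map (Sym2.map e) → f G₁ = f G₂

def GraphParam.Additive (f : Multigraph → ℝ) : Prop :=
  ∀ G₁ G₂ : Multigraph, f (G₁.disjUnion G₂) = f G₁ + f G₂

def GraphParam.Lipschitz (f : Multigraph → ℝ) (κ : ℝ) : Prop :=
  ∀ (G : Multigraph) (i j : G.V), |f (G.addEdge i j) - f G| ≤ κ

def GraphParam.Concave (f : Multigraph → ℝ) : Prop :=
  ∀ (G : Multigraph) (x : G.V → ℝ), (∑ i, x i) = 0 →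
    ∑ i, ∑ j, (f (G.addEdge i j) - f G) * x i * x j ≤ 0

abbrev HalfEdge (V : Type) (d : V → ℕ) : Type := Σ i : V, Fin (d i)

def IsPairMatching {α : Type} (m : Finset (Sym2 α)) : Prop :=
  (∀ p ∈ m, ¬ p.IsDiag) ∧
    ∀ p ∈ m, ∀ q ∈ m, p ≠ q → ∀ h : α, h ∈ p → h ∉ q

def IsMaximalMatching {α : Type} (m : Finset (Sym2 α)) : Prop :=
  IsPairMatching m ∧ ∀ m' : Finset (Sym2 α), IsPairMatching m' → m ⊆ m' → m' = m

/-- The multigraph `G[m]` induced on `V` by a matching `m` of the half-edges. -/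
def matchingGraph (V : Type) [Fintype V] (d : V → ℕ)
    (m : Finset (Sym2 (HalfEdge V d))) : Multigraph :=
  { V := V, edges := m.val.map (Sym2.map Sigma.fst) }

noncomputable def maximalMatchings (V : Type) [Fintype V] [DecidableEq V] (d : V → ℕ) :
    Finset (Finset (Sym2 (HalfEdge V d))) :=
  Finset.univ.filter fun m => IsMaximalMatching m

/-- `E[f(𝔾_d)]`: expectation of `f` under the configuration model with degrees `d`. -/
noncomputable def configExpect (V : Type) [Fintype V] [DecidableEq V] (d : V → ℕ)
    (f : Multigraph → ℝ) : ℝ :=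
  (∑ m ∈ maximalMatchings V d, f (matchingGraph V d m)) / ((maximalMatchings V d).card : ℝ)

/-- `E[f(𝔾^iid_{μ,n})]`. -/
noncomputable def iidExpect (μ : ℕ → ℝ) (n : ℕ) (f : Multigraph → ℝ) : ℝ :=
  ∑' D : Fin n → ℕ, (∏ i, μ (D i)) * configExpect (Fin n) D f

noncomputable def tailSum (μ : ℕ → ℝ) (i : ℕ) : ℝ := ∑' k : ℕ, if i ≤ k then μ k else 0

/-- The Wasserstein distance `W(μ, μ') = Σ_{i≥1} |Σ_{k≥i} (μ k - μ' k)|`. -/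
noncomputable def wasserstein (μ μ' : ℕ → ℝ) : ℝ :=
  ∑' i : ℕ, |tailSum μ (i + 1) - tailSum μ' (i + 1)|

/-- Empirical degree distribution of `d : Fin n → ℕ`. -/
noncomputable def empirical (n : ℕ) (d : Fin n → ℕ) : ℕ → ℝ :=
  fun k => ((Finset.univ.filter fun i => d i = k).card : ℝ) / (n : ℝ)

/-- The degree sequences `d n` approach the degree distribution `μ` (with mean `Σ k·μ(k)`). -/
def Approaches (d : (n : ℕ) → Fin n → ℕ) (μ : ℕ → ℝ) : Prop :=
  (∀ k : ℕ, Tendsto (fun n => empirical n (d n) k) atTop (nhds (μ k))) ∧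
    Tendsto (fun n => (∑ i, (d n i : ℝ)) / (n : ℝ)) atTop
      (nhds (∑' k : ℕ, (k : ℝ) * μ k))

/-- `x` is not covered by `m`. -/
def Unc {α : Type} (m : Finset (Sym2 α)) (x : α) : Prop := ∀ p ∈ m, x ∉ p

lemma isMaximal_iff {α : Type} (m : Finset (Sym2 α)) :
    IsMaximalMatching m ↔ IsPairMatching m ∧ ∀ x y, Unc m x → Unc m y → x = y := by
  constructor
  · rintro ⟨h, hmax⟩
    refine ⟨h, fun x y hx hy => ?_⟩
    by_contra hne
    have h2 : insert s(x, y) m = m := by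
      apply hmax
      · constructor
        · intro p hp
          rcases Finset.mem_insert.1 hp with rfl | hp
          · simpa using hne
          · exact h.1 p hp
        · intro p hp q hq hpq z hzp hzq
          rcases Finset.mem_insert.1 hp with rfl | hp1 <;> rcases Finset.mem_insert.1 hq with rfl | hq1
          · exact hpq rfl
          · rcases Sym2.mem_iff.1 hzp with rfl | rfl
            · exact hx q hq1 hzq
            · exact hy q hq1 hzq
          · rcases Sym2.mem_iff.1 hzq with rfl | rfl
            · exact hx p hp1 hzp
            · exact hy p hp1 hzp
          · exact h.2 p hp1 q hq1 hpq z hzp hzq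
      · exact Finset.subset_insert _ _
    have : s(x, y) ∈ m := h2 ▸ Finset.mem_insert_self _ _
    exact hx _ this (by simp)
  · rintro ⟨h, hu⟩
    refine ⟨h, fun m' hm' hsub => ?_⟩
    apply Finset.Subset.antisymm _ hsub
    intro p hp
    by_contra hpm
    have key : ∀ z ∈ p, Unc m z := by
      intro z hz q hq hzq
      exact hm'.2 p hp q (hsub hq) (fun h => hpm (h ▸ hq)) z hz hzq
    induction p using Sym2.ind with
    | _ x y =>
      have := hu x y (key x (by simp)) (key y (by simp))
      exact hm'.1 _ hp (by simpa using this)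

lemma card_eq_of_matching {α : Type} [Fintype α] (m : Finset (Sym2 α)) (h : IsPairMatching m) :
    Fintype.card α = 2 * m.card + (Finset.univ.filter fun x => Unc m x).card := by
  have h1 : (m.biUnion Sym2.toFinset).card = 2 * m.card := by
    rw [Finset.card_biUnion]
    · rw [Finset.sum_congr rfl (fun p hp => Sym2.card_toFinset_of_not_isDiag p (h.1 p hp))]
      simp [mul_comm]
    · intro p hp q hq hpq
      rw [Function.onFun, Finset.disjoint_left]
      intro z hz hz'
      exact h.2 p hp q hq hpq z (by simpa using hz) (by simpa using hz')
  have h2 : (Finset.univ.filter fun x => Unc m x) = (m.biUnion Sym2.toFinset)ᶜ := by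
    ext x
    rw [Finset.mem_filter]
    simp [Unc]
  rw [h2, Finset.card_compl, h1]
  have := Finset.card_le_univ (m.biUnion Sym2.toFinset)
  omega

lemma perfect_of_even {α : Type} [Fintype α] (m : Finset (Sym2 α)) (h : IsMaximalMatching m)
    (he : Even (Fintype.card α)) (x : α) : ¬ Unc m x := by
  intro hx
  rw [isMaximal_iff] at h
  have h1 := card_eq_of_matching m h.1
  have h2 : (Finset.univ.filter fun x => Unc m x) = {x} := by
    ext y
    simp only [Finset.mem_filter, Finset.mem_univ, true_and, Finset.mem_singleton]
    exact ⟨fun hy => h.2 y x hy hx, fun hy => hy ▸ hx⟩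
  rw [h2] at h1
  obtain ⟨k, hk⟩ := he
  simp at h1
  omega

lemma exists_unc_of_odd {α : Type} [Fintype α] (m : Finset (Sym2 α)) (h : IsPairMatching m)
    (he : ¬ Even (Fintype.card α)) : ∃ x : α, Unc m x := by
  by_contra! hx
  have h1 := card_eq_of_matching m h
  apply he
  rw [h1]
  simp [hx]

lemma mem_map_sym2 {α β : Type} (ι : α ↪ β) (m : Finset (Sym2 α)) (x : α) (p : Sym2 β) 
    (hp : p ∈ m.map ι.sym2Map) : ι x ∈ p ↔ ∃ q ∈ m, x ∈ q ∧ q.map ι = p := by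
  obtain ⟨q, hq, rfl⟩ := Finset.mem_map.1 hp
  constructor
  · intro h
    refine ⟨q, hq, ?_, rfl⟩
    obtain ⟨y, hy, hxy⟩ := Sym2.mem_map.1 h
    exact ι.injective hxy ▸ hy
  · rintro ⟨q', hq', hx, he⟩
    change ι x ∈ Sym2.map ι q
    change _ = Sym2.map ι q at he
    rw [← he]
    exact Sym2.mem_map.2 ⟨x, hx, rfl⟩

lemma unc_map {α β : Type} (ι : α ↪ β) (m : Finset (Sym2 α)) (x : α) :
    Unc (m.map ι.sym2Map) (ι x) ↔ Unc m x := by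
  constructor
  · intro h q hq hx
    have := Finset.mem_map_of_mem ι.sym2Map hq
    refine h _ this ?_
    exact Sym2.mem_map.2 ⟨x, hx, rfl⟩
  · intro h p hp hx
    obtain ⟨q, hq, hxq, _⟩ := (mem_map_sym2 ι m x p hp).1 hx
    exact h q hq hxq

lemma unc_map_not_range {α β : Type} (ι : α ↪ β) (m : Finset (Sym2 α)) (y : β)
    (hy : ∀ x, ι x ≠ y) : Unc (m.map ι.sym2Map) y := by
  intro p hp hyp
  obtain ⟨q, hq, rfl⟩ := Finset.mem_map.1 hp
  obtain ⟨x, _, hx⟩ := Sym2.mem_map.1 hyp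
  exact hy x hx

lemma pair_map {α β : Type} (ι : α ↪ β) (m : Finset (Sym2 α)) :
    IsPairMatching (m.map ι.sym2Map) ↔ IsPairMatching m := by
  have hd : ∀ p : Sym2 α, (ι.sym2Map p).IsDiag ↔ p.IsDiag := by
    intro p
    induction p using Sym2.ind with
    | _ x y => simp
  have hm : ∀ (p : Sym2 α) x, ι x ∈ ι.sym2Map p ↔ x ∈ p := by
    intro p x
    induction p using Sym2.ind with
    | _ a b => simp
  constructor
  · intro h
    constructor
    · intro p hp hpd
      exact h.1 _ (Finset.mem_map_of_mem ι.sym2Map hp) ((hd p).2 hpd)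
    · intro p hp q hq hpq x hxp hxq
      exact h.2 _ (Finset.mem_map_of_mem ι.sym2Map hp) _ (Finset.mem_map_of_mem ι.sym2Map hq)
        (fun e => hpq (ι.sym2Map.injective e)) (ι x) ((hm p x).2 hxp) ((hm q x).2 hxq)
  · intro h
    constructor
    · intro p' hp' hpd
      obtain ⟨p, hp, rfl⟩ := Finset.mem_map.1 hp'
      exact h.1 _ hp ((hd p).1 hpd)
    · intro p' hp' q' hq' hpq y hyp hyq
      obtain ⟨p, hp, rfl⟩ := Finset.mem_map.1 hp'
      obtain ⟨q, hq, rfl⟩ := Finset.mem_map.1 hq'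
      obtain ⟨x, hx, rfl⟩ := Sym2.mem_map.1 hyp
      exact h.2 p hp q hq (fun e => hpq (e ▸ rfl)) x hx ((hm q x).1 hyq)

lemma maximal_map_equiv {α β : Type} (e : α ≃ β) (m : Finset (Sym2 α)) :
    IsMaximalMatching (m.map e.toEmbedding.sym2Map) ↔ IsMaximalMatching m := by
  rw [isMaximal_iff, isMaximal_iff, pair_map]
  refine and_congr_right fun _ => ?_
  constructor
  · intro h x y hx hy
    exact e.injective (h (e x) (e y) ((unc_map e.toEmbedding m x).2 hx)
      ((unc_map e.toEmbedding m y).2 hy))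
  · intro h x y hx hy
    obtain ⟨x, rfl⟩ := e.surjective x
    obtain ⟨y, rfl⟩ := e.surjective y
    rw [h x y ((unc_map e.toEmbedding m x).1 hx) ((unc_map e.toEmbedding m y).1 hy)]

/-- a matching missing everything outside the range comes from the domain -/
lemma exists_map_of_unc {α β : Type} (ι : α ↪ β) (b : Finset (Sym2 β))
    (h : ∀ y, (∀ x, ι x ≠ y) → Unc b y) : ∃ a : Finset (Sym2 α), b = a.map ι.sym2Map := by
  have : (b : Set (Sym2 β)) ⊆ ι.sym2Map '' Set.univ := by
    intro p hp
    have hr : ∀ y ∈ p, ∃ x, ι x = y := by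
      intro y hy
      by_contra! hne
      exact h y hne p hp hy
    induction p using Sym2.ind with
    | _ y z =>
      obtain ⟨x, rfl⟩ := hr y (by simp)
      obtain ⟨x', rfl⟩ := hr z (by simp)
      exact ⟨s(x, x'), trivial, rfl⟩
  obtain ⟨a, _, ha⟩ := Finset.subset_set_image_iff.1 this
  refine ⟨a, ?_⟩
  rw [← ha, Finset.map_eq_image]

/-- average over a finset -/
noncomputable def avg {ι : Type} (A : Finset ι) (F : ι → ℝ) : ℝ := (∑ a ∈ A, F a) / (A.card : ℝ)

lemma avg_bij {ι ι' : Type} (A : Finset ι) (B : Finset ι') (F : ι → ℝ) (G : ι' → ℝ)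
    (X : Type) [Fintype X] (hX : 0 < Fintype.card X) (φ : ι → X → ι')
    (hmem : ∀ a ∈ A, ∀ x, φ a x ∈ B)
    (hinj : ∀ a ∈ A, ∀ x, ∀ a' ∈ A, ∀ x', φ a x = φ a' x' → a = a' ∧ x = x')
    (hsurj : ∀ b ∈ B, ∃ a ∈ A, ∃ x, φ a x = b)
    (K : ℝ) (hK : 0 ≤ K) (hFG : ∀ a ∈ A, ∀ x, |G (φ a x) - F a| ≤ K) :
    |avg B G - avg A F| ≤ K := by
  have hs : ∀ g : ι' → ℝ, ∑ b ∈ B, g b = ∑ a ∈ A, ∑ x : X, g (φ a x) := by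
    intro g
    rw [← Finset.sum_product']
    symm
    refine Finset.sum_bij (fun q _ => φ q.1 q.2) ?_ ?_ ?_ ?_
    · rintro ⟨a, x⟩ h
      exact hmem a (Finset.mem_product.1 h).1 x
    · rintro ⟨a, x⟩ h ⟨a', x'⟩ h' he
      obtain ⟨rfl, rfl⟩ := hinj a (Finset.mem_product.1 h).1 x a' (Finset.mem_product.1 h').1 x' he
      rfl
    · intro b hb
      obtain ⟨a, ha, x, rfl⟩ := hsurj b hb
      exact ⟨(a, x), by simp [ha], rfl⟩
    · intros; rfl
  have hc : (B.card : ℝ) = A.card * Fintype.card X := by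
    have := hs (fun _ => 1)
    simpa using this
  have hX' : (0 : ℝ) < Fintype.card X := by exact_mod_cast hX
  rcases A.eq_empty_or_nonempty with rfl | hA
  · simp [avg, hs, hK]
  have hA' : (0 : ℝ) < A.card := by exact_mod_cast hA.card_pos
  have : avg B G - avg A F = (∑ a ∈ A, ∑ x : X, (G (φ a x) - F a)) / (A.card * Fintype.card X) := by
    unfold avg
    rw [hs, hc]
    simp only [Finset.sum_sub_distrib, Finset.sum_const, Finset.card_univ, nsmul_eq_mul,
      ← Finset.mul_sum]
    field_simp
  rw [this, abs_div, abs_of_pos (mul_pos hA' hX'), div_le_iff₀ (mul_pos hA' hX')]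
  calc |∑ a ∈ A, ∑ x : X, (G (φ a x) - F a)| ≤ ∑ a ∈ A, ∑ x : X, |G (φ a x) - F a| :=
        (Finset.abs_sum_le_sum_abs _ _).trans
          (Finset.sum_le_sum fun a _ => Finset.abs_sum_le_sum_abs _ _)
    _ ≤ ∑ a ∈ A, ∑ x : X, K := Finset.sum_le_sum fun a ha => Finset.sum_le_sum fun x _ => hFG a ha x
    _ = K * (A.card * Fintype.card X) := by simp; ring

/-- graph with labels -/
def lgraph {α V : Type} [Fintype V] (ℓ : α → V) (m : Finset (Sym2 α)) : Multigraph :=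
  { V := V, edges := m.val.map (Sym2.map ℓ) }

lemma lgraph_map {α β V : Type} [Fintype V] (ι : α ↪ β) (ℓ : β → V) (m : Finset (Sym2 α)) :
    lgraph ℓ (m.map ι.sym2Map) = lgraph (ℓ ∘ ι) m := by
  unfold lgraph
  congr 1
  rw [Finset.map_val, Multiset.map_map]
  apply Multiset.map_congr rfl
  intro p _
  exact Sym2.map_map p

lemma lip_insert {f : Multigraph → ℝ} {κ : ℝ} (hlip : GraphParam.Lipschitz f κ)
    {α V : Type} [Fintype V] (ℓ : α → V) (m : Finset (Sym2 α)) (p : Sym2 α) (hp : p ∉ m) :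
    |f (lgraph ℓ (insert p m)) - f (lgraph ℓ m)| ≤ κ := by
  induction p using Sym2.ind with
  | _ x y =>
    have : lgraph ℓ (insert s(x, y) m) = (lgraph ℓ m).addEdge (ℓ x) (ℓ y) := by
      unfold lgraph Multigraph.addEdge
      congr 1
      rw [Finset.insert_val_of_notMem hp]
      simp
    rw [this]
    exact hlip _ _ _

lemma step {f : Multigraph → ℝ} {κ : ℝ} (hlip : GraphParam.Lipschitz f κ) (hκ : 0 ≤ κ)
    {α V : Type} [Fintype α] [Fintype V] (ℓ : Option α → V)
    (A : Finset (Finset (Sym2 α))) (hA : ∀ m, m ∈ A ↔ IsMaximalMatching m)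
    (B : Finset (Finset (Sym2 (Option α)))) (hB : ∀ m, m ∈ B ↔ IsMaximalMatching m) :
    |avg B (fun m => f (lgraph ℓ m)) - avg A (fun m => f (lgraph (ℓ ∘ some) m))| ≤ 2 * κ := by
  by_cases he : Even (Fintype.card α)
  · let ι : Option α → α ↪ Option α := fun x =>
      Function.Embedding.some.trans (Equiv.swap none x).toEmbedding
    have hι : ∀ x y, ι x y = Equiv.swap none x (some y) := fun _ _ => rfl
    have hne : ∀ x y, ι x y ≠ x := by
      intro x y h
      rw [hι] at h
      have := congrArg (Equiv.swap none x) h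
      simp at this
    have hrange : ∀ x z, (∀ y, ι x y ≠ z) → z = x := by
      intro x z h
      rcases hz : Equiv.swap none x z with _ | w
      · have := congrArg (Equiv.swap none x) hz
        simpa using this
      · exfalso
        apply h w
        rw [hι, ← hz]
        simp
    have huncx : ∀ (a : Finset (Sym2 α)), IsMaximalMatching a → ∀ x z,
        Unc (a.map (ι x).sym2Map) z → z = x := by
      intro a ha x z hz
      apply hrange
      rintro y rfl
      exact perfect_of_even a ha he y ((unc_map _ _ _).1 hz)
    refine avg_bij A B _ _ (Option α) Fintype.card_pos (fun a x => a.map (ι x).sym2Map)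
      ?_ ?_ ?_ _ (by linarith) ?_
    · intro a ha x
      rw [hA] at ha
      rw [hB, isMaximal_iff]
      refine ⟨(pair_map _ _).2 ha.1, fun z w hz hw => ?_⟩
      rw [huncx a ha x z hz, huncx a ha x w hw]
    · intro a ha x a' ha' x' h
      rw [hA] at ha ha'
      have hx : x = x' := by
        apply huncx a' ha'
        rw [← h]
        exact unc_map_not_range _ _ _ (hne x)
      subst hx
      exact ⟨Finset.map_injective _ h, rfl⟩
    · intro b hb
      rw [hB] at hb
      obtain ⟨x, hx⟩ := exists_unc_of_odd b hb.1 (by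
        rw [Fintype.card_option]; exact fun h => (Nat.even_add_one.1 h) he)
      obtain ⟨a, rfl⟩ := exists_map_of_unc (ι x) b (by
        intro y hy
        rw [hrange x y hy]
        exact hx)
      refine ⟨a, ?_, x, rfl⟩
      rw [isMaximal_iff] at hb
      rw [hA, isMaximal_iff]
      refine ⟨(pair_map _ _).1 hb.1, fun y z hy hz => ?_⟩
      exact (ι x).injective (hb.2 _ _ ((unc_map _ _ _).2 hy) ((unc_map _ _ _).2 hz))
    · intro a ha x
      rw [hA] at ha
      simp only [lgraph_map]
      rcases x with _ | x
      · have : ℓ ∘ (ι none) = ℓ ∘ some := by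
          funext y
          simp [hι]
        rw [this]
        simpa using hκ
      · have hx := perfect_of_even a ha he x
        unfold Unc at hx
        push Not at hx
        obtain ⟨p, hp, hxp⟩ := hx
        have hcong : lgraph (ℓ ∘ ι (some x)) (a.erase p) = lgraph (ℓ ∘ some) (a.erase p) := by
          unfold lgraph
          congr 1
          apply Multiset.map_congr rfl
          intro q hq
          have hq' := Finset.mem_erase.1 hq
          have hxq : x ∉ q := ha.1.2 p hp q hq'.2 (Ne.symm hq'.1) x hxp
          apply Sym2.map_congr
          intro y hy
          have : y ≠ x := fun h => hxq (h ▸ hy)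
          simp only [Function.comp, hι]
          rw [Equiv.swap_apply_of_ne_of_ne] <;> simp [this]
        have h1 := lip_insert hlip (ℓ ∘ ι (some x)) (a.erase p) p (Finset.notMem_erase _ _)
        have h2 := lip_insert hlip (ℓ ∘ some) (a.erase p) p (Finset.notMem_erase _ _)
        rw [Finset.insert_erase hp] at h1 h2
        rw [hcong] at h1
        rw [abs_le] at *
        constructor <;> linarith
  · have hex : ∀ a : Finset (Sym2 α), ∃ u, IsMaximalMatching a → Unc a u := by
      intro a
      by_cases h : IsMaximalMatching a
      · obtain ⟨u, hu⟩ := exists_unc_of_odd a h.1 he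
        exact ⟨u, fun _ => hu⟩
      · have : Nonempty α := by
          by_contra hc
          rw [not_nonempty_iff] at hc
          exact he (by simp)
        exact ⟨Classical.arbitrary α, fun h' => absurd h' h⟩
    choose u hu using hex
    have heven : Even (Fintype.card (Option α)) := by
      rw [Fintype.card_option]; exact Nat.even_add_one.2 he
    let ι : α ↪ Option α := Function.Embedding.some
    have hnone : ∀ a : Finset (Sym2 α), Unc (a.map ι.sym2Map) none := fun a =>
      unc_map_not_range _ _ _ (by intro x; simp [ι])
    have hnot : ∀ (a : Finset (Sym2 α)) y, s(none, some y) ∉ a.map ι.sym2Map := fun a y h =>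
      hnone a _ h (by simp)
    have huniq : ∀ a, IsMaximalMatching a → ∀ y, Unc a y → y = u a := fun a ha y hy =>
      ((isMaximal_iff a).1 ha).2 _ _ hy (hu a ha)
    refine avg_bij A B _ _ Unit (by simp) (fun a _ => insert s(none, some (u a)) (a.map ι.sym2Map))
      ?_ ?_ ?_ _ (by linarith) ?_
    · intro a ha _
      rw [hA] at ha
      have hsome : Unc (a.map ι.sym2Map) (some (u a)) := (unc_map ι a (u a)).2 (hu a ha)
      rw [hB, isMaximal_iff]
      have hpm := (pair_map ι a).2 ha.1
      refine ⟨⟨?_, ?_⟩, ?_⟩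
      · intro p hp
        rcases Finset.mem_insert.1 hp with rfl | hp
        · simp
        · exact hpm.1 p hp
      · intro p hp q hq hpq z hzp hzq
        rcases Finset.mem_insert.1 hp with rfl | hp <;> rcases Finset.mem_insert.1 hq with rfl | hq
        · exact hpq rfl
        · rcases Sym2.mem_iff.1 hzp with rfl | rfl
          · exact hnone a q hq hzq
          · exact hsome q hq hzq
        · rcases Sym2.mem_iff.1 hzq with rfl | rfl
          · exact hnone a p hp hzp
          · exact hsome p hp hzp
        · exact hpm.2 p hp q hq hpq z hzp hzq
      · intro x y hx _
        exfalso
        have hx0 := hx _ (Finset.mem_insert_self _ _)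
        rcases x with _ | x
        · simp at hx0
        · apply hx0
          have : Unc a x := (unc_map ι a x).1 (fun p hp => hx p (Finset.mem_insert_of_mem hp))
          rw [huniq a ha x this]
          simp
    · intro a ha _ a' ha' _ h
      refine ⟨?_, rfl⟩
      apply Finset.map_injective ι.sym2Map
      have key : ∀ a : Finset (Sym2 α), a.map ι.sym2Map =
          (insert s(none, some (u a)) (a.map ι.sym2Map)).filter (fun p => none ∉ p) := by
        intro a
        ext p
        simp only [Finset.mem_filter, Finset.mem_insert]
        constructor
        · intro hp
          exact ⟨Or.inr hp, hnone a p hp⟩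
        · rintro ⟨rfl | hp, h⟩
          · simp at h
          · exact hp
      rw [key a, key a']
      rw [h]
    · intro b hb
      rw [hB] at hb
      have h0 := perfect_of_even b hb heven none
      unfold Unc at h0
      push Not at h0
      obtain ⟨p, hp, hnp⟩ := h0
      obtain ⟨w, rfl⟩ := Sym2.mem_iff_exists.1 hnp
      rcases w with _ | w
      · exact absurd (by simp) (hb.1.1 _ hp)
      obtain ⟨a, ha⟩ := exists_map_of_unc ι (b.erase s(none, some w)) (by
        intro y hy q hq hyq
        have hy' : y = none := by
          rcases y with _ | y
          · rfl
          · exact absurd rfl (hy y)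
        subst hy'
        have hq' := Finset.mem_erase.1 hq
        exact hb.1.2 _ hp q hq'.2 (Ne.symm hq'.1) none (by simp) hyq)
      have hbb : insert s(none, some w) (a.map ι.sym2Map) = b := by
        rw [← ha, Finset.insert_erase hp]
      have hpa : IsPairMatching a := by
        rw [← pair_map ι, ← ha]
        exact ⟨fun p hp => hb.1.1 p (Finset.mem_of_mem_erase hp), fun p hp q hq =>
          hb.1.2 p (Finset.mem_of_mem_erase hp) q (Finset.mem_of_mem_erase hq)⟩
      have hw : ∀ y, Unc a y → y = w := by
        intro y hy
        have h1 := perfect_of_even b hb heven (some y)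
        unfold Unc at h1
        push Not at h1
        obtain ⟨q, hq, hyq⟩ := h1
        rw [← hbb] at hq
        rcases Finset.mem_insert.1 hq with rfl | hq
        · simpa using hyq
        · exact absurd hyq ((unc_map ι a y).2 hy q hq)
      have hma : IsMaximalMatching a :=
        (isMaximal_iff a).2 ⟨hpa, fun x y hx hy => by rw [hw x hx, hw y hy]⟩
      refine ⟨a, (hA a).2 hma, (), ?_⟩
      rw [hw (u a) (hu a hma), hbb]
    · intro a ha _
      have h1 := lip_insert hlip ℓ (a.map ι.sym2Map) s(none, some (u a)) (hnot a _)
      rw [lgraph_map] at h1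
      have h3 : κ ≤ 2 * κ := by linarith
      refine le_trans ?_ h3
      convert h1 using 5
      · rfl
      · congr!
      · rfl

lemma avg_equiv {f : Multigraph → ℝ} 
    {α β V : Type} [Fintype V] (e : α ≃ β) (ℓ : β → V)
    (A : Finset (Finset (Sym2 α))) (hA : ∀ m, m ∈ A ↔ IsMaximalMatching m)
    (B : Finset (Finset (Sym2 β))) (hB : ∀ m, m ∈ B ↔ IsMaximalMatching m) :
    avg B (fun m => f (lgraph ℓ m)) = avg A (fun m => f (lgraph (ℓ ∘ e) m)) := by
  have := avg_bij A B (fun m => f (lgraph (ℓ ∘ e) m)) (fun m => f (lgraph ℓ m)) Unit (by simp)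
    (fun a _ => a.map e.toEmbedding.sym2Map) ?_ ?_ ?_ 0 le_rfl ?_
  · exact sub_eq_zero.1 (abs_nonpos_iff.1 this)
  · intro a ha _
    rw [hB, maximal_map_equiv, ← hA]
    exact ha
  · intro a _ _ a' _ _ h
    exact ⟨Finset.map_injective _ h, rfl⟩
  · intro b hb
    obtain ⟨a, rfl⟩ := exists_map_of_unc e.toEmbedding b (fun y hy =>
      absurd (e.apply_symm_apply y) (hy (e.symm y)))
    refine ⟨a, ?_, (), rfl⟩
    rw [hA, ← maximal_map_equiv e, ← hB]
    exact hb
  · intro a _ _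
    rw [lgraph_map]
    simp

lemma mem_mm (V : Type) [Fintype V] [DecidableEq V] (d : V → ℕ) (m) :
    m ∈ maximalMatchings V d ↔ IsMaximalMatching m := by
  simp [maximalMatchings]

lemma config_eq_avg (V : Type) [Fintype V] [DecidableEq V] (d : V → ℕ) (f : Multigraph → ℝ) :
    configExpect V d f = avg (maximalMatchings V d) (fun m => f (lgraph Sigma.fst m)) := rfl

lemma config_perm {f : Multigraph → ℝ} (hinv : GraphParam.Invariant f)
    (V : Type) [Fintype V] [DecidableEq V] (d : V → ℕ) (σ : Equiv.Perm V) :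
    configExpect V (d ∘ σ) f = configExpect V d f := by
  rw [config_eq_avg, config_eq_avg]
  let e : HalfEdge V (d ∘ σ) ≃ HalfEdge V d := Equiv.sigmaCongrLeft (β := fun i => Fin (d i)) σ
  rw [avg_equiv (f := f) e Sigma.fst _ (mem_mm V (d ∘ σ)) _ (mem_mm V d)]
  unfold avg
  congr 1
  apply Finset.sum_congr rfl
  intro m _
  apply hinv _ _ σ
  unfold lgraph
  simp only [Multiset.map_map]
  apply Multiset.map_congr rfl
  intro p _
  simp only [Function.comp_apply]
  rw [Sym2.map_map]
  rfl

lemma config_step {f : Multigraph → ℝ} {κ : ℝ} (hlip : GraphParam.Lipschitz f κ) (hκ : 0 ≤ κ)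
    (V : Type) [Fintype V] [DecidableEq V] (d : V → ℕ) (i : V) :
    |configExpect V (Function.update d i (d i + 1)) f - configExpect V d f| ≤ 2 * κ := by
  rw [config_eq_avg, config_eq_avg]
  set d' := Function.update d i (d i + 1) with hd'
  have hle : ∀ j, d j ≤ d' j := by
    intro j
    by_cases h : j = i
    · subst h; simp [hd']
    · simp [hd', h]
  have hi : d i < d' i := by simp [hd']
  let g : Option (HalfEdge V d) → HalfEdge V d' := fun o =>
    match o with
    | none => ⟨i, ⟨d i, hi⟩⟩
    | some ⟨j, s⟩ => ⟨j, Fin.castLE (hle j) s⟩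
  have hg : Function.Bijective g := by
    constructor
    · rintro (_ | ⟨j, s⟩) (_ | ⟨j', s'⟩) h
      · rfl
      · exfalso
        simp only [g, Sigma.mk.injEq] at h
        obtain ⟨rfl, h⟩ := h
        have := congrArg Fin.val (eq_of_heq h)
        have h2 := s'.2
        simp at this
        omega
      · exfalso
        simp only [g, Sigma.mk.injEq] at h
        obtain ⟨rfl, h⟩ := h
        have := congrArg Fin.val (eq_of_heq h)
        have h2 := s.2
        simp at this
        omega
      · simp only [g, Sigma.mk.injEq] at h
        obtain ⟨rfl, h⟩ := h
        have := congrArg Fin.val (eq_of_heq h)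
        have : s = s' := Fin.ext (by simpa using this)
        rw [this]
    · rintro ⟨j, s⟩
      by_cases hs : s.1 < d j
      · exact ⟨some ⟨j, ⟨s.1, hs⟩⟩, rfl⟩
      · have hs2 := s.2
        by_cases h : j = i
        · subst h
          refine ⟨none, ?_⟩
          simp only [g]
          congr 1
          apply Fin.ext
          simp [hd'] at hs2 hs ⊢
          omega
        · simp [hd', h] at hs2 hs
          omega
  let e := Equiv.ofBijective g hg
  let C : Finset (Finset (Sym2 (Option (HalfEdge V d)))) := Finset.univ.filter IsMaximalMatching
  have hC : ∀ m, m ∈ C ↔ IsMaximalMatching m := by simp [C]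
  rw [avg_equiv (f := f) e Sigma.fst C hC _ (mem_mm V d')]
  have := step (f := f) hlip hκ ((Sigma.fst : HalfEdge V d' → V) ∘ e) _ (mem_mm V d) C hC
  have h2 : (((Sigma.fst : HalfEdge V d' → V) ∘ e) ∘ some) = (Sigma.fst : HalfEdge V d → V) := by
    funext ⟨j, s⟩
    rfl
  rw [h2] at this
  exact this

lemma lip_dist {V : Type} [Fintype V] [DecidableEq V] (g : (V → ℕ) → ℝ) (K : ℝ)
    (hg : ∀ d i, |g (Function.update d i (d i + 1)) - g d| ≤ K) :
    ∀ (k : ℕ) (d d' : V → ℕ), ∑ i, Nat.dist (d i) (d' i) = k → |g d - g d'| ≤ K * k := by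
  intro k
  induction k with
  | zero =>
    intro d d' h
    have : d = d' := by
      funext i
      have := (Finset.sum_eq_zero_iff.1 h) i (Finset.mem_univ i)
      exact Nat.eq_of_dist_eq_zero this
    simp [this]
  | succ k ih =>
    have main : ∀ (d d' : V → ℕ) (i : V), d i < d' i → ∑ i, Nat.dist (d i) (d' i) = k + 1 →
        |g d - g d'| ≤ K * ((k + 1 : ℕ) : ℝ) := by
      intro d d' i hi h
      have h1 := hg d i
      have h2 := ih (Function.update d i (d i + 1)) d' (by
        rw [← Finset.add_sum_erase _ _ (Finset.mem_univ i)] at h ⊢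
        have : ∑ x ∈ Finset.univ.erase i, Nat.dist (Function.update d i (d i + 1) x) (d' x) =
            ∑ x ∈ Finset.univ.erase i, Nat.dist (d x) (d' x) := by
          apply Finset.sum_congr rfl
          intro x hx
          rw [Function.update_of_ne (Finset.ne_of_mem_erase hx)]
        rw [this]
        simp only [Function.update_self, Nat.dist] at h ⊢
        omega)
      push_cast
      rw [abs_le] at *
      constructor <;> linarith
    intro d d' h
    have : ∃ i, d i ≠ d' i := by
      by_contra! hc
      simp [hc, Nat.dist_self] at h
    obtain ⟨i, hi⟩ := this
    rcases lt_or_gt_of_ne hi with hi | hi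
    · exact main d d' i hi h
    · rw [abs_sub_comm]
      refine main d' d i hi ?_
      rw [← h]
      exact Finset.sum_congr rfl fun _ _ => Nat.dist_comm _ _

lemma tail_emp (n : ℕ) (d : Fin n → ℕ) (k : ℕ) :
    tailSum (empirical n d) k = (∑ i, if k ≤ d i then (1 : ℝ) else 0) / n := by
  unfold tailSum empirical
  rw [tsum_eq_sum (s := Finset.univ.image d)]
  · have : ∀ x : ℕ, (if k ≤ x then ((Finset.univ.filter fun i => d i = x).card : ℝ) / (n : ℝ) else 0)
        = (∑ i, if d i = x then (if k ≤ d i then (1 : ℝ) else 0) else 0) / n := by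
      intro x
      split_ifs with h
      · congr 1
        rw [Finset.card_filter]
        push_cast
        apply Finset.sum_congr rfl
        intro i _
        split_ifs with h1 h2 h2 <;> first | rfl | (exfalso; omega)
      · rw [Finset.sum_eq_zero]
        · simp
        · intro i _
          split_ifs with h1 h2 h2 <;> first | rfl | (exfalso; omega)
    rw [Finset.sum_congr rfl (fun x _ => this x), ← Finset.sum_div, Finset.sum_comm]
    congr 1
    apply Finset.sum_congr rfl
    intro i _
    rw [Finset.sum_ite_eq]
    simp
  · intro x hx
    have : (Finset.univ.filter fun i => d i = x) = ∅ := by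
      ext i
      simp only [Finset.mem_image, Finset.mem_univ, true_and, not_exists] at hx
      simp [hx i]
    simp [this]

lemma dist_layer (a b M : ℕ) (ha : a ≤ M) (hb : b ≤ M) :
    (Nat.dist a b : ℝ) = ∑ k ∈ Finset.range M,
      |(if k + 1 ≤ a then (1 : ℝ) else 0) - (if k + 1 ≤ b then (1 : ℝ) else 0)| := by
  wlog h : a ≤ b generalizing a b
  · rw [Nat.dist_comm, this b a hb ha (by omega)]
    exact Finset.sum_congr rfl fun _ _ => abs_sub_comm _ _
  have : ∀ k ∈ Finset.range M, 
      |(if k + 1 ≤ a then (1 : ℝ) else 0) - (if k + 1 ≤ b then (1 : ℝ) else 0)| =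
        if k ∈ Finset.Ico a b then 1 else 0 := by
    intro k _
    simp only [Finset.mem_Ico]
    split_ifs <;> first | (exfalso; omega) | simp
  rw [Finset.sum_congr rfl this, Finset.sum_ite_mem, Finset.sum_const]
  have : Finset.range M ∩ Finset.Ico a b = Finset.Ico a b := by
    ext x; simp; omega
  rw [this]
  simp [Nat.dist_eq_sub_of_le h]

lemma mono_layer (n : ℕ) (d d' : Fin n → ℕ) (hd : Monotone d) (hd' : Monotone d') (k : ℕ) :
    ∑ i, |(if k ≤ d i then (1 : ℝ) else 0) - (if k ≤ d' i then (1 : ℝ) else 0)| =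
    |(∑ i, if k ≤ d i then (1 : ℝ) else 0) - ∑ i, if k ≤ d' i then (1 : ℝ) else 0| := by
  rw [← Finset.sum_sub_distrib]
  by_cases h : ∀ i, k ≤ d i → k ≤ d' i
  · rw [abs_of_nonpos, ← Finset.sum_neg_distrib]
    · apply Finset.sum_congr rfl
      intro i _
      have := h i
      apply abs_of_nonpos
      split_ifs <;> first | (exfalso; omega) | norm_num
    · apply Finset.sum_nonpos
      intro i _
      have := h i
      split_ifs <;> first | (exfalso; omega) | norm_num
  · push Not at h
    obtain ⟨j, hj, hj'⟩ := h
    have h : ∀ i, k ≤ d' i → k ≤ d i := by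
      intro i hi
      rcases le_total i j with hij | hij
      · have := hd' hij; omega
      · have := hd hij; omega
    rw [abs_of_nonneg]
    · apply Finset.sum_congr rfl
      intro i _
      have := h i
      apply abs_of_nonneg
      split_ifs <;> first | (exfalso; omega) | norm_num
    · apply Finset.sum_nonneg
      intro i _
      have := h i
      split_ifs <;> first | (exfalso; omega) | norm_num

lemma wass_eq (n : ℕ) (hn : 1 ≤ n) (d d' : Fin n → ℕ) (hd : Monotone d) (hd' : Monotone d') :
    wasserstein (empirical n d) (empirical n d') =
      ((∑ i, Nat.dist (d i) (d' i) : ℕ) : ℝ) / n := by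
  obtain ⟨M, hM, hM'⟩ : ∃ M, (∀ i, d i ≤ M) ∧ ∀ i, d' i ≤ M := by
    refine ⟨∑ i, (d i + d' i), fun i => ?_, fun i => ?_⟩
    · have := Finset.single_le_sum (f := fun i => d i + d' i) (fun _ _ => Nat.zero_le _)
        (Finset.mem_univ i)
      omega
    · have := Finset.single_le_sum (f := fun i => d i + d' i) (fun _ _ => Nat.zero_le _)
        (Finset.mem_univ i)
      omega
  have hn' : (0 : ℝ) < n := by exact_mod_cast hn
  unfold wasserstein
  simp only [tail_emp, ← sub_div, abs_div, abs_of_pos hn', ← mono_layer n d d' hd hd']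
  rw [tsum_eq_sum (s := Finset.range M)]
  · rw [← Finset.sum_div, Finset.sum_comm]
    push_cast
    congr 1
    apply Finset.sum_congr rfl
    intro i _
    rw [dist_layer _ _ M (hM i) (hM' i)]
  · intro k hk
    rw [Finset.mem_range] at hk
    rw [Finset.sum_eq_zero]
    · simp
    · intro i _
      have := hM i
      have := hM' i
      rw [if_neg (by omega), if_neg (by omega)]
      simp

lemma wass_perm (n : ℕ) (d d' : Fin n → ℕ) (σ σ' : Equiv.Perm (Fin n)) :
    wasserstein (empirical n (d ∘ σ)) (empirical n (d' ∘ σ')) =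
      wasserstein (empirical n d) (empirical n d') := by
  have : ∀ (d : Fin n → ℕ) (σ : Equiv.Perm (Fin n)) k,
      tailSum (empirical n (d ∘ σ)) k = tailSum (empirical n d) k := by
    intro d σ k
    rw [tail_emp, tail_emp]
    congr 1
    exact Equiv.sum_comp σ (fun i => if k ≤ d i then (1 : ℝ) else 0)
  unfold wasserstein
  simp only [this]

theorem statement4 (f : Multigraph → ℝ) (κ : ℝ)
    (hinv : GraphParam.Invariant f) (hadd : GraphParam.Additive f)
    (hlip : GraphParam.Lipschitz f κ)
    (n : ℕ) (hn : 1 ≤ n) (d d' : Fin n → ℕ) :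
    |configExpect (Fin n) d f / (n : ℝ) - configExpect (Fin n) d' f / (n : ℝ)| ≤
      2 * κ * wasserstein (empirical n d) (empirical n d') := by
  have hκ : 0 ≤ κ := (abs_nonneg _).trans
    (hlip { V := Unit, edges := 0 } () ())
  have hn' : (0 : ℝ) < n := by exact_mod_cast hn
  rw [← wass_perm n d d' (Tuple.sort d) (Tuple.sort d'), ← config_perm hinv (Fin n) d (Tuple.sort d),
    ← config_perm hinv (Fin n) d' (Tuple.sort d'),
    wass_eq n hn _ _ (Tuple.monotone_sort d) (Tuple.monotone_sort d'),
    ← sub_div, abs_div, abs_of_pos hn', ← mul_div_assoc]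
  apply div_le_div_of_nonneg_right _ hn'.le
  exact lip_dist (fun d => configExpect (Fin n) d f) (2 * κ)
    (fun d i => config_step hlip hκ (Fin n) d i) _ _ _ rfl
end

section
/- Fix a finite set V partitioned into disjoint sets A and B and d : V → ℕ, and let (α, β, γ) ∈ ℕ³. Let m be uniformly distributed on M(α, β, γ). (i) If conditionally on m one adds to m a uniformly chosen pair of two distinct unmatched half-edges whose endpoints both lie in A (assuming such a pair exists), the resulting matching m' is uniformly distributed on M(α+1, β, γ). (ii) If one adds a uniformly chosen pair of two distinct unmatched half-edges whose endpoints both lie in B, the result is uniformly distributed on M(α, β+1, γ). (iii) If one adds a uniformly chosen pair of unmatched half-edges, one with endpoint in A and the other with endpoint in B, the result is uniformly distributed on M(α, β, γ+1). -/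
open Finset Filter Topology MeasureTheory
open scoped Classical BigOperators ENNReal

def Unmatched {α : Type} (m : Finset (Sym2 α)) (h : α) : Prop := ∀ p ∈ m, h ∉ p

def bothEnds {V : Type} {d : V → ℕ} (A : Finset V) (p : Sym2 (HalfEdge V d)) : Prop :=
  ∀ h ∈ p, h.1 ∈ A

def crossEnds {V : Type} {d : V → ℕ} (A B : Finset V) (p : Sym2 (HalfEdge V d)) : Prop :=
  (∃ h ∈ p, h.1 ∈ A) ∧ (∃ h ∈ p, h.1 ∈ B)

/-- `M(α, β, γ)`: matchings with `α` pairs inside `A`, `β` pairs inside `B`, `γ` cross pairs. -/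
noncomputable def Mset (V : Type) [Fintype V] [DecidableEq V] (d : V → ℕ) (A B : Finset V)
    (a b c : ℕ) : Finset (Finset (Sym2 (HalfEdge V d))) :=
  Finset.univ.filter fun m => IsPairMatching m ∧
    (m.filter fun p => bothEnds A p).card = a ∧
    (m.filter fun p => bothEnds B p).card = b ∧
    (m.filter fun p => crossEnds A B p).card = c

/-- `F(α, β, γ)`: the average of `f (G[m])` over `m ∈ M(α, β, γ)`. -/
noncomputable def Fav (V : Type) [Fintype V] [DecidableEq V] (d : V → ℕ) (A B : Finset V)
    (f : Multigraph → ℝ) (a b c : ℕ) : ℝ :=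
  (∑ m ∈ Mset V d A B a b c, f (matchingGraph V d m)) / ((Mset V d A B a b c).card : ℝ)

/-- `(α, β, γ)` is feasible: `2α + γ ≤ d(A)` and `2β + γ ≤ d(B)`. -/
def Feasible (V : Type) [Fintype V] (d : V → ℕ) (A B : Finset V) (a b c : ℕ) : Prop :=
  2 * a + c ≤ ∑ i ∈ A, d i ∧ 2 * b + c ≤ ∑ i ∈ B, d i

/-- Pairs of two distinct unmatched half-edges, both with endpoints in `A`. -/
noncomputable def pairsWithin (V : Type) [Fintype V] [DecidableEq V] (d : V → ℕ)
    (A : Finset V) (m : Finset (Sym2 (HalfEdge V d))) : Finset (Sym2 (HalfEdge V d)) :=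
  Finset.univ.filter fun p => ¬ p.IsDiag ∧ ∀ h ∈ p, h.1 ∈ A ∧ Unmatched m h

/-- Pairs of two unmatched half-edges, one with endpoint in `A`, the other in `B`. -/
noncomputable def pairsAcross (V : Type) [Fintype V] [DecidableEq V] (d : V → ℕ)
    (A B : Finset V) (m : Finset (Sym2 (HalfEdge V d))) : Finset (Sym2 (HalfEdge V d)) :=
  Finset.univ.filter fun p => ¬ p.IsDiag ∧ (∀ h ∈ p, Unmatched m h) ∧
    (∃ h ∈ p, h.1 ∈ A) ∧ (∃ h ∈ p, h.1 ∈ B)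

/-- Abstract double counting. -/
theorem double_count_aux {M P : Type} [DecidableEq M] (S T : Finset M) (f : M → Finset P)
    (ins : P → M → M) (K N : ℕ)
    (hK : ∀ m ∈ S, (f m).card = K) (hN0 : 0 < N)
    (hinj : ∀ m ∈ S, ∀ p ∈ f m, ∀ q ∈ f m, ins p m = ins q m → p = q)
    (hT : ∀ m ∈ S, ∀ p ∈ f m, ins p m ∈ T)
    (hN : ∀ m₂ ∈ T, (S.filter fun m₁ => ∃ p ∈ f m₁, m₂ = ins p m₁).card = N)
    (m₂ : M) (hm₂ : m₂ ∈ T) :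
    (S.card : ℝ)⁻¹ * ∑ m₁ ∈ S, (if ∃ p ∈ f m₁, m₂ = ins p m₁ then ((f m₁).card : ℝ)⁻¹ else 0)
      = (T.card : ℝ)⁻¹ := by
  have h1 : ∑ m₁ ∈ S, (if ∃ p ∈ f m₁, m₂ = ins p m₁ then ((f m₁).card : ℝ)⁻¹ else 0)
      = N * (K : ℝ)⁻¹ := by
    rw [← hN m₂ hm₂, ← Finset.sum_filter, ← nsmul_eq_mul]
    apply Finset.sum_eq_card_nsmul
    intro m hm
    rw [hK m (Finset.mem_filter.1 hm).1]
  have hcount : S.card * K = T.card * N := by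
    have := Finset.sum_card_bipartiteAbove_eq_sum_card_bipartiteBelow
      (s := S) (t := T) (fun m₁ m₂ => ∃ p ∈ f m₁, m₂ = ins p m₁)
    rw [Finset.sum_congr rfl (g := fun _ => K), Finset.sum_congr (s₁ := T) rfl (g := fun _ => N)] at this
    · simpa using this
    · intro x hx
      exact hN x hx
    · intro m hm
      rw [← hK m hm]
      have : Finset.bipartiteAbove (fun m₁ m₂ => ∃ p ∈ f m₁, m₂ = ins p m₁) T m
          = (f m).image (fun p => ins p m) := by
        ext x
        simp only [Finset.bipartiteAbove, Finset.mem_filter, Finset.mem_image]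
        constructor
        · rintro ⟨_, p, hp, rfl⟩
          exact ⟨p, hp, rfl⟩
        · rintro ⟨p, hp, rfl⟩
          exact ⟨hT m hm p hp, p, hp, rfl⟩
      rw [this, Finset.card_image_of_injOn]
      intro p hp q hq h
      exact hinj m hm p hp q hq h
  have hTpos : 0 < T.card := Finset.card_pos.2 ⟨m₂, hm₂⟩
  have hpos : 0 < S.card * K := by rw [hcount]; positivity
  have hS : (S.card : ℝ) ≠ 0 := by
    have := Nat.pos_of_mul_pos_right hpos
    intro h
    simp only [Nat.cast_eq_zero] at h
    simp [h] at hpos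
  have hKK : (K : ℝ) ≠ 0 := by
    intro h
    simp only [Nat.cast_eq_zero] at h
    simp [h] at hpos
  have hTT : (T.card : ℝ) ≠ 0 := by exact_mod_cast hTpos.ne'
  rw [h1]
  have : (S.card : ℝ) * K = T.card * N := by exact_mod_cast hcount
  field_simp
  linarith

theorem sym2_exists_mem_aux {α : Type} (p : Sym2 α) : ∃ h, h ∈ p := by
  induction p with
  | _ x y => exact ⟨x, by simp⟩

/-- The pairs of kind `Q` which may be added to `m`. -/
noncomputable def addable (V : Type) [Fintype V] [DecidableEq V] (d : V → ℕ)
    (Q : Sym2 (HalfEdge V d) → Prop) (m : Finset (Sym2 (HalfEdge V d))) :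
    Finset (Sym2 (HalfEdge V d)) :=
  Finset.univ.filter fun p => ¬ p.IsDiag ∧ Q p ∧ ∀ h ∈ p, Unmatched m h

theorem mem_addable_aux {V : Type} [Fintype V] [DecidableEq V] {d : V → ℕ}
    {Q : Sym2 (HalfEdge V d) → Prop} {m : Finset (Sym2 (HalfEdge V d))} {p} :
    p ∈ addable V d Q m ↔ ¬ p.IsDiag ∧ Q p ∧ ∀ h ∈ p, Unmatched m h := by
  unfold addable
  rw [Finset.mem_filter]
  exact and_iff_right (Finset.mem_univ p)

theorem addable_notMem {V : Type} [Fintype V] [DecidableEq V] {d : V → ℕ}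
    {Q : Sym2 (HalfEdge V d) → Prop} {m : Finset (Sym2 (HalfEdge V d))} {p}
    (hp : p ∈ addable V d Q m) : p ∉ m := by
  intro hm
  simp only [mem_addable_aux, Finset.mem_filter, Finset.mem_univ, true_and] at hp
  obtain ⟨h, hh⟩ := sym2_exists_mem_aux p
  exact hp.2.2 h hh p hm hh

theorem insert_matching {V : Type} [Fintype V] [DecidableEq V] {d : V → ℕ}
    {Q : Sym2 (HalfEdge V d) → Prop} {m : Finset (Sym2 (HalfEdge V d))} {p}
    (hm : IsPairMatching m) (hp : p ∈ addable V d Q m) : IsPairMatching (insert p m) := by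
  simp only [mem_addable_aux, Finset.mem_filter, Finset.mem_univ, true_and] at hp
  obtain ⟨h1, _, h3⟩ := hp
  refine ⟨?_, ?_⟩
  · intro q hq
    rcases Finset.mem_insert.1 hq with rfl | hq
    · exact h1
    · exact hm.1 q hq
  · intro q hq r hr hne h hhq hhr
    rcases Finset.mem_insert.1 hq with rfl | hqm
    · rcases Finset.mem_insert.1 hr with rfl | hr
      · exact hne rfl
      · exact h3 h hhq r hr hhr
    · rcases Finset.mem_insert.1 hr with rfl | hr
      · exact h3 h hhr q hqm hhq
      · exact hm.2 q hqm r hr hne h hhq hhr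

theorem erase_matching {V : Type} [Fintype V] [DecidableEq V] {d : V → ℕ}
    {Q : Sym2 (HalfEdge V d) → Prop} {m : Finset (Sym2 (HalfEdge V d))} {p}
    (hm : IsPairMatching m) (hp : p ∈ m) (hQ : Q p) :
    IsPairMatching (m.erase p) ∧ p ∈ addable V d Q (m.erase p) := by
  refine ⟨⟨fun q hq => hm.1 q (Finset.mem_of_mem_erase hq), fun q hq r hr =>
    hm.2 q (Finset.mem_of_mem_erase hq) r (Finset.mem_of_mem_erase hr)⟩, ?_⟩
  simp only [mem_addable_aux, Finset.mem_filter, Finset.mem_univ, true_and]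
  refine ⟨hm.1 p hp, hQ, ?_⟩
  intro h hh q hq
  exact hm.2 p hp q (Finset.mem_of_mem_erase hq) (Finset.ne_of_mem_erase hq).symm h hh

/-- Key lemma, abstract in the kind `Q` of the added pair. -/
theorem key_aux {V : Type} [Fintype V] [DecidableEq V] {d : V → ℕ}
    (Q : Sym2 (HalfEdge V d) → Prop) (S T : Finset (Finset (Sym2 (HalfEdge V d)))) (N K : ℕ)
    (hTm : ∀ m ∈ T, IsPairMatching m ∧ (m.filter fun p => Q p).card = N + 1)
    (hins : ∀ m ∈ S, ∀ p ∈ addable V d Q m, insert p m ∈ T)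
    (hers : ∀ m ∈ T, ∀ p ∈ m, Q p → m.erase p ∈ S)
    (hK : ∀ m ∈ S, (addable V d Q m).card = K)
    (hne : ∀ m ∈ S, (addable V d Q m).Nonempty) (m₂) (hm₂ : m₂ ∈ T) :
    (S.card : ℝ)⁻¹ * ∑ m₁ ∈ S, (if ∃ p ∈ addable V d Q m₁, m₂ = insert p m₁
      then ((addable V d Q m₁).card : ℝ)⁻¹ else 0) = (T.card : ℝ)⁻¹ := by
  refine double_count_aux S T (addable V d Q) (fun p m => insert p m) K (N + 1) hK
    (Nat.succ_pos N) ?_ hins ?_ m₂ hm₂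
  · intro m hm p hp q hq h
    have : p ∈ insert q m := by
      have h' : insert p m = insert q m := h
      rw [← h']; exact Finset.mem_insert_self p m
    rcases Finset.mem_insert.1 this with h | h
    · exact h
    · exact absurd h (addable_notMem hp)
  · intro m hm
    rw [← (hTm m hm).2]
    symm
    apply Finset.card_bij (fun p _ => m.erase p)
    · intro p hp
      rw [Finset.mem_filter] at hp
      rw [Finset.mem_filter]
      exact ⟨hers m hm p hp.1 hp.2, p, (erase_matching (hTm m hm).1 hp.1 hp.2).2,
        (Finset.insert_erase hp.1).symm⟩
    · intro p hp q hq h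
      rw [Finset.mem_filter] at hp hq
      by_contra hne
      have : q ∈ m.erase p := Finset.mem_erase.2 ⟨fun h => hne h.symm, hq.1⟩
      rw [h] at this
      exact Finset.notMem_erase q m this
    · intro m₁ hm₁
      rw [Finset.mem_filter] at hm₁
      obtain ⟨_, p, hp, rfl⟩ := hm₁
      have hQ : Q p := by
        simp only [mem_addable_aux, Finset.mem_filter, Finset.mem_univ, true_and] at hp
        exact hp.2.1
      exact ⟨p, Finset.mem_filter.2 ⟨Finset.mem_insert_self p m₁, hQ⟩,
        Finset.erase_insert (addable_notMem hp)⟩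

/-- The unmatched half-edges with endpoint in `A`. -/
noncomputable def freeIn (V : Type) [Fintype V] [DecidableEq V] (d : V → ℕ) (A : Finset V)
    (m : Finset (Sym2 (HalfEdge V d))) : Finset (HalfEdge V d) :=
  Finset.univ.filter fun h => h.1 ∈ A ∧ Unmatched m h

theorem mem_freeIn_aux {V : Type} [Fintype V] [DecidableEq V] {d : V → ℕ} {A : Finset V}
    {m : Finset (Sym2 (HalfEdge V d))} {h : HalfEdge V d} :
    h ∈ freeIn V d A m ↔ h.1 ∈ A ∧ Unmatched m h := by
  unfold freeIn
  rw [Finset.mem_filter]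
  exact and_iff_right (Finset.mem_univ h)

theorem pair_count {V : Type} [Fintype V] [DecidableEq V] {d : V → ℕ} {A B : Finset V}
    (hAB : Disjoint A B) (hUnion : A ∪ B = Finset.univ) (p : Sym2 (HalfEdge V d))
    (hp : ¬ p.IsDiag) :
    (Finset.univ.filter fun h : HalfEdge V d => h.1 ∈ A ∧ h ∈ p).card
      = 2 * (if bothEnds A p then 1 else 0) + (if crossEnds A B p then 1 else 0) := by
  have hB : ∀ v, v ∈ B ↔ v ∉ A := by
    intro v
    have h1 : v ∈ A ∪ B := by rw [hUnion]; exact Finset.mem_univ v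
    have h2 : v ∈ A → v ∉ B := fun hv => Finset.disjoint_left.1 hAB hv
    rw [Finset.mem_union] at h1
    tauto
  induction p with
  | _ x y =>
    have hxy : x ≠ y := by simpa using hp
    have e : (Finset.univ.filter fun h : HalfEdge V d => h.1 ∈ A ∧ h ∈ s(x, y))
        = ({x, y} : Finset (HalfEdge V d)).filter fun h => h.1 ∈ A := by
      ext h
      simp [and_comm]
    rw [e]
    simp only [bothEnds, crossEnds, hB, Sym2.mem_iff, Finset.filter_insert, Finset.filter_singleton]
    by_cases hx : x.1 ∈ A <;> by_cases hy : y.1 ∈ A <;> simp [hx, hy, hxy]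

theorem freeIn_card {V : Type} [Fintype V] [DecidableEq V] {d : V → ℕ} {A B : Finset V}
    (hAB : Disjoint A B) (hUnion : A ∪ B = Finset.univ) (m : Finset (Sym2 (HalfEdge V d)))
    (hm : IsPairMatching m) :
    (freeIn V d A m).card + (2 * (m.filter fun p => bothEnds A p).card
      + (m.filter fun p => crossEnds A B p).card)
      = (Finset.univ.filter fun h : HalfEdge V d => h.1 ∈ A).card := by
  have h1 : (m.biUnion fun p => Finset.univ.filter fun h : HalfEdge V d => h.1 ∈ A ∧ h ∈ p).card
      = 2 * (m.filter fun p => bothEnds A p).card + (m.filter fun p => crossEnds A B p).card := by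
    rw [Finset.card_biUnion]
    · rw [Finset.sum_congr rfl fun p hp => pair_count hAB hUnion p (hm.1 p hp)]
      rw [Finset.sum_add_distrib, ← Finset.mul_sum, Finset.card_filter, Finset.card_filter]
    · intro p hp q hq hne
      refine Finset.disjoint_left.2 ?_
      intro h h1 h2
      simp only [Finset.mem_filter, Finset.mem_univ, true_and] at h1 h2
      exact hm.2 p hp q hq hne h h1.2 h2.2
  rw [← h1, ← Finset.card_union_of_disjoint]
  · congr 1
    ext h
    simp only [mem_freeIn_aux, Unmatched, Finset.mem_union, Finset.mem_filter, Finset.mem_univ, true_and,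
      Finset.mem_biUnion]
    constructor
    · rintro (h | ⟨_, _, h, _⟩)
      · exact h.1
      · exact h
    · intro hA
      by_cases hh : ∃ p ∈ m, h ∈ p
      · obtain ⟨p, hp, hh⟩ := hh
        exact Or.inr ⟨p, hp, hA, hh⟩
      · push Not at hh
        exact Or.inl ⟨hA, hh⟩
  · rw [Finset.disjoint_left]
    intro h h1 h2
    simp only [mem_freeIn_aux, Finset.mem_filter, Finset.mem_univ, true_and, Finset.mem_biUnion] at h1 h2
    obtain ⟨p, hp, _, hh⟩ := h2
    exact h1.2 p hp hh

theorem addable_within_card {V : Type} [Fintype V] [DecidableEq V] {d : V → ℕ} (A : Finset V)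
    (m : Finset (Sym2 (HalfEdge V d))) :
    (addable V d (bothEnds A) m).card = (freeIn V d A m).card.choose 2 := by
  rw [← Sym2.card_image_offDiag]
  congr 1
  ext p
  induction p with
  | _ x y =>
    simp only [mem_addable_aux, bothEnds, mem_freeIn_aux, Finset.mem_filter, Finset.mem_univ, true_and,
      Finset.mem_image, Finset.mem_offDiag, Prod.exists, Sym2.mk_isDiag_iff, Sym2.mem_iff]
    constructor
    · rintro ⟨h1, h2, h3⟩
      exact ⟨x, y, ⟨⟨h2 x (Or.inl rfl), h3 x (Or.inl rfl)⟩,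
        ⟨h2 y (Or.inr rfl), h3 y (Or.inr rfl)⟩, h1⟩, rfl⟩
    · rintro ⟨u, v, ⟨hu, hv, huv⟩, h⟩
      rcases Sym2.eq_iff.1 h with ⟨rfl, rfl⟩ | ⟨rfl, rfl⟩
      · refine ⟨huv, ?_, ?_⟩ <;> rintro z (rfl | rfl) <;> simp_all
      · refine ⟨huv.symm, ?_, ?_⟩ <;> rintro z (rfl | rfl) <;> simp_all

theorem addable_across_card {V : Type} [Fintype V] [DecidableEq V] {d : V → ℕ} {A B : Finset V}
    (hAB : Disjoint A B) (m : Finset (Sym2 (HalfEdge V d))) :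
    (addable V d (crossEnds A B) m).card = (freeIn V d A m).card * (freeIn V d B m).card := by
  have hd : ∀ v, v ∈ A → v ∉ B := fun v hv => Finset.disjoint_left.1 hAB hv
  rw [← Finset.card_product]
  symm
  apply Finset.card_bij (fun q _ => s(q.1, q.2))
  · rintro ⟨x, y⟩ hq
    simp only [mem_freeIn_aux, Finset.mem_product, Finset.mem_filter, Finset.mem_univ, true_and] at hq
    obtain ⟨⟨hx, hx'⟩, hy, hy'⟩ := hq
    simp only [mem_addable_aux, crossEnds, Finset.mem_filter, Finset.mem_univ, true_and,
      Sym2.mk_isDiag_iff, Sym2.mem_iff]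
    refine ⟨?_, ⟨⟨x, Or.inl rfl, hx⟩, ⟨y, Or.inr rfl, hy⟩⟩, ?_⟩
    · rintro rfl
      exact hd _ hx hy
    · rintro h (rfl | rfl) <;> assumption
  · rintro ⟨x, y⟩ hq ⟨u, v⟩ hq' h
    simp only [mem_freeIn_aux, Finset.mem_product, Finset.mem_filter, Finset.mem_univ, true_and] at hq hq'
    rcases Sym2.eq_iff.1 h with ⟨h1, h2⟩ | ⟨h1, h2⟩
    · exact Prod.ext h1 h2
    · simp only at h1 h2
      subst h1 h2
      exact absurd hq'.2.1 (hd _ hq.1.1)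
  · intro p hp
    simp only [mem_addable_aux, crossEnds, Finset.mem_filter, Finset.mem_univ, true_and] at hp
    obtain ⟨h1, ⟨⟨x, hx, hxA⟩, y, hy, hyB⟩, h3⟩ := hp
    refine ⟨(x, y), ?_, ?_⟩
    · simp only [mem_freeIn_aux, Finset.mem_product, Finset.mem_filter, Finset.mem_univ, true_and]
      exact ⟨⟨hxA, h3 x hx⟩, hyB, h3 y hy⟩
    · have hne : x ≠ y := by
        rintro rfl
        exact hd _ hxA hyB
      exact ((Sym2.mem_and_mem_iff hne).1 ⟨hx, hy⟩).symm

theorem filter_insert_card {α : Type} [DecidableEq α] (m : Finset α) (p : α) (hp : p ∉ m)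
    (Q : α → Prop) [DecidablePred Q] :
    ((insert p m).filter fun p => Q p).card = (m.filter fun p => Q p).card + if Q p then 1 else 0 := by
  rw [Finset.filter_insert]
  split_ifs
  · rw [Finset.card_insert_of_notMem (by simp [hp])]
  · rfl

theorem filter_erase_card {α : Type} [DecidableEq α] (m : Finset α) (p : α) (hp : p ∈ m)
    (Q : α → Prop) [DecidablePred Q] :
    (m.filter fun p => Q p).card = ((m.erase p).filter fun p => Q p).card + if Q p then 1 else 0 := by
  rw [← filter_insert_card _ _ (Finset.notMem_erase p m), Finset.insert_erase hp]

theorem kinds_aux {V : Type} {d : V → ℕ} {A B : Finset V}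
    (hAB : Disjoint A B) (p : Sym2 (HalfEdge V d)) :
    ¬ (bothEnds A p ∧ bothEnds B p) ∧ ¬ (bothEnds A p ∧ crossEnds A B p) ∧
      ¬ (bothEnds B p ∧ crossEnds A B p) := by
  have hd : ∀ v, v ∈ A → v ∉ B := fun v hv => Finset.disjoint_left.1 hAB hv
  obtain ⟨h, hh⟩ := sym2_exists_mem_aux p
  refine ⟨fun ⟨h1, h2⟩ => hd _ (h1 h hh) (h2 h hh), ?_, ?_⟩
  · rintro ⟨h1, _, u, hu, hB⟩
    exact hd _ (h1 u hu) hB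
  · rintro ⟨h1, ⟨u, hu, hA⟩, _⟩
    exact hd _ hA (h1 u hu)

theorem crossEnds_comm_aux {V : Type} {d : V → ℕ} (A B : Finset V) (p : Sym2 (HalfEdge V d)) :
    crossEnds B A p ↔ crossEnds A B p := and_comm

theorem freeA_aux {V : Type} [Fintype V] [DecidableEq V] {d : V → ℕ} {A B : Finset V}
    (hAB : Disjoint A B) (hUnion : A ∪ B = Finset.univ) {a b c : ℕ}
    {m : Finset (Sym2 (HalfEdge V d))} (hm : m ∈ Mset V d A B a b c) :
    (freeIn V d A m).card
      = (Finset.univ.filter fun h : HalfEdge V d => h.1 ∈ A).card - (2 * a + c) ∧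
    (freeIn V d B m).card
      = (Finset.univ.filter fun h : HalfEdge V d => h.1 ∈ B).card - (2 * b + c) := by
  simp only [Mset, Finset.mem_filter, Finset.mem_univ, true_and] at hm
  obtain ⟨h0, h1, h2, h3⟩ := hm
  have e1 := freeIn_card hAB hUnion m h0
  have e2 := freeIn_card hAB.symm (by rw [Finset.union_comm]; exact hUnion) m h0
  simp only [crossEnds_comm_aux A B] at e2
  constructor <;> omega

theorem pairsWithin_eq_aux {V : Type} [Fintype V] [DecidableEq V] {d : V → ℕ} (A : Finset V) :
    pairsWithin V d A = addable V d (bothEnds A) := by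
  funext m
  ext p
  simp only [pairsWithin, mem_addable_aux, bothEnds, Finset.mem_filter, Finset.mem_univ, true_and]
  exact and_congr_right fun _ => ⟨fun h => ⟨fun x hx => (h x hx).1, fun x hx => (h x hx).2⟩,
    fun h x hx => ⟨h.1 x hx, h.2 x hx⟩⟩

theorem pairsAcross_eq_aux {V : Type} [Fintype V] [DecidableEq V] {d : V → ℕ} (A B : Finset V) :
    pairsAcross V d A B = addable V d (crossEnds A B) := by
  funext m
  ext p
  simp only [pairsAcross, mem_addable_aux, crossEnds, Finset.mem_filter, Finset.mem_univ, true_and]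
  tauto

theorem mem_addable_kind {V : Type} [Fintype V] [DecidableEq V] {d : V → ℕ}
    {Q : Sym2 (HalfEdge V d) → Prop} {m : Finset (Sym2 (HalfEdge V d))} {p}
    (hp : p ∈ addable V d Q m) : Q p := by
  simp only [mem_addable_aux, Finset.mem_filter, Finset.mem_univ, true_and] at hp
  exact hp.2.1

theorem statement6 (V : Type) [Fintype V] [DecidableEq V] (A B : Finset V)
    (hAB : Disjoint A B) (hUnion : A ∪ B = Finset.univ) (d : V → ℕ) (a b c : ℕ) :
    ((∀ m₁ ∈ Mset V d A B a b c, (pairsWithin V d A m₁).Nonempty) →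
      ∀ m₂ ∈ Mset V d A B (a + 1) b c,
        ((Mset V d A B a b c).card : ℝ)⁻¹ *
          ∑ m₁ ∈ Mset V d A B a b c,
            (if ∃ p ∈ pairsWithin V d A m₁, m₂ = insert p m₁
             then ((pairsWithin V d A m₁).card : ℝ)⁻¹ else 0)
          = ((Mset V d A B (a + 1) b c).card : ℝ)⁻¹) ∧
    ((∀ m₁ ∈ Mset V d A B a b c, (pairsWithin V d B m₁).Nonempty) →
      ∀ m₂ ∈ Mset V d A B a (b + 1) c,
        ((Mset V d A B a b c).card : ℝ)⁻¹ *
          ∑ m₁ ∈ Mset V d A B a b c,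
            (if ∃ p ∈ pairsWithin V d B m₁, m₂ = insert p m₁
             then ((pairsWithin V d B m₁).card : ℝ)⁻¹ else 0)
          = ((Mset V d A B a (b + 1) c).card : ℝ)⁻¹) ∧
    ((∀ m₁ ∈ Mset V d A B a b c, (pairsAcross V d A B m₁).Nonempty) →
      ∀ m₂ ∈ Mset V d A B a b (c + 1),
        ((Mset V d A B a b c).card : ℝ)⁻¹ *
          ∑ m₁ ∈ Mset V d A B a b c,
            (if ∃ p ∈ pairsAcross V d A B m₁, m₂ = insert p m₁
             then ((pairsAcross V d A B m₁).card : ℝ)⁻¹ else 0)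
          = ((Mset V d A B a b (c + 1)).card : ℝ)⁻¹) := by
  rw [pairsWithin_eq_aux, pairsWithin_eq_aux, pairsAcross_eq_aux]
  refine ⟨fun hne m₂ hm₂ => ?_, fun hne m₂ hm₂ => ?_, fun hne m₂ hm₂ => ?_⟩
  · refine key_aux (bothEnds A) _ _ a _ ?_ ?_ ?_
      (fun m hm => by rw [addable_within_card, (freeA_aux hAB hUnion hm).1]) hne m₂ hm₂
    · intro m hm
      simp only [Mset, Finset.mem_filter, Finset.mem_univ, true_and] at hm
      exact ⟨hm.1, hm.2.1⟩
    · intro m hm p hp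
      have hQ := mem_addable_kind hp
      have hk := kinds_aux hAB p
      have hn := addable_notMem hp
      simp only [Mset, Finset.mem_filter, Finset.mem_univ, true_and] at hm ⊢
      refine ⟨insert_matching hm.1 hp, ?_⟩
      rw [filter_insert_card _ _ hn, filter_insert_card _ _ hn, filter_insert_card _ _ hn]
      simp_all
    · intro m hm p hp hQ
      have hk := kinds_aux hAB p
      simp only [Mset, Finset.mem_filter, Finset.mem_univ, true_and] at hm ⊢
      refine ⟨(erase_matching hm.1 hp hQ).1, ?_⟩
      rw [filter_erase_card _ _ hp, filter_erase_card _ _ hp, filter_erase_card _ _ hp] at hm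
      simp_all
  · refine key_aux (bothEnds B) _ _ b _ ?_ ?_ ?_
      (fun m hm => by rw [addable_within_card, (freeA_aux hAB hUnion hm).2]) hne m₂ hm₂
    · intro m hm
      simp only [Mset, Finset.mem_filter, Finset.mem_univ, true_and] at hm
      exact ⟨hm.1, hm.2.2.1⟩
    · intro m hm p hp
      have hQ := mem_addable_kind hp
      have hk := kinds_aux hAB p
      have hn := addable_notMem hp
      simp only [Mset, Finset.mem_filter, Finset.mem_univ, true_and] at hm ⊢
      refine ⟨insert_matching hm.1 hp, ?_⟩
      rw [filter_insert_card _ _ hn, filter_insert_card _ _ hn, filter_insert_card _ _ hn]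
      simp_all
    · intro m hm p hp hQ
      have hk := kinds_aux hAB p
      simp only [Mset, Finset.mem_filter, Finset.mem_univ, true_and] at hm ⊢
      refine ⟨(erase_matching hm.1 hp hQ).1, ?_⟩
      rw [filter_erase_card _ _ hp, filter_erase_card _ _ hp, filter_erase_card _ _ hp] at hm
      simp_all
  · refine key_aux (crossEnds A B) _ _ c _ ?_ ?_ ?_
      (fun m hm => by rw [addable_across_card hAB, (freeA_aux hAB hUnion hm).1,
        (freeA_aux hAB hUnion hm).2]) hne m₂ hm₂
    · intro m hm
      simp only [Mset, Finset.mem_filter, Finset.mem_univ, true_and] at hm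
      exact ⟨hm.1, hm.2.2.2⟩
    · intro m hm p hp
      have hQ := mem_addable_kind hp
      have hk := kinds_aux hAB p
      have hn := addable_notMem hp
      simp only [Mset, Finset.mem_filter, Finset.mem_univ, true_and] at hm ⊢
      refine ⟨insert_matching hm.1 hp, ?_⟩
      rw [filter_insert_card _ _ hn, filter_insert_card _ _ hn, filter_insert_card _ _ hn]
      simp_all
    · intro m hm p hp hQ
      have hk := kinds_aux hAB p
      simp only [Mset, Finset.mem_filter, Finset.mem_univ, true_and] at hm ⊢
      refine ⟨(erase_matching hm.1 hp hQ).1, ?_⟩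
      rw [filter_erase_card _ _ hp, filter_erase_card _ _ hp, filter_erase_card _ _ hp] at hm
      simp_all
end

section
/- Let 𝔣 be a κ-Lipschitz graph parameter, let V = A ∪ B be a finite set partitioned into disjoint sets A and B, and let d : V → ℕ. Then for any feasible triples (α, β, γ) and (α', β', γ'), |F(α, β, γ) − F(α', β', γ')| ≤ κ·(|α − α'| + |β − β'| + |γ − γ'|). -/
open Finset Filter Topology MeasureTheory
open scoped Classical BigOperators ENNReal

/-- Double counting comparison of averages. -/
theorem s7_avg {M P : Type} (S S' : Finset M) (E : Finset (M × P)) (φ : M × P → M)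
    (g : M → ℝ) (κ : ℝ) (hκ : 0 ≤ κ) (N K : ℕ) (hN : 0 < N) (hK : 0 < K)
    (h1 : ∀ x ∈ E, x.1 ∈ S) (h2 : ∀ x ∈ E, φ x ∈ S')
    (hS : ∀ m ∈ S, (E.filter fun x => x.1 = m).card = N)
    (hS' : ∀ m ∈ S', (E.filter fun x => φ x = m).card = K)
    (hg : ∀ x ∈ E, |g (φ x) - g x.1| ≤ κ) :
    |(∑ m ∈ S', g m) / (S'.card : ℝ) - (∑ m ∈ S, g m) / (S.card : ℝ)| ≤ κ := by
  have e1 : ∑ x ∈ E, g x.1 = N * ∑ m ∈ S, g m := by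
    rw [← Finset.sum_fiberwise_of_maps_to h1, Finset.mul_sum]
    refine Finset.sum_congr rfl fun m hm => ?_
    rw [Finset.sum_congr rfl (g := fun _ => g m), Finset.sum_const, hS m hm, nsmul_eq_mul]
    intro x hx
    rw [(Finset.mem_filter.1 hx).2]
  have e2 : ∑ x ∈ E, g (φ x) = K * ∑ m ∈ S', g m := by
    rw [← Finset.sum_fiberwise_of_maps_to h2, Finset.mul_sum]
    refine Finset.sum_congr rfl fun m hm => ?_
    rw [Finset.sum_congr rfl (g := fun _ => g m), Finset.sum_const, hS' m hm, nsmul_eq_mul]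
    intro x hx
    rw [(Finset.mem_filter.1 hx).2]
  have c1 : (E.card : ℝ) = N * S.card := by
    rw [Finset.card_eq_sum_card_fiberwise h1, Finset.sum_congr rfl hS]
    simp [mul_comm]
  have c2 : (E.card : ℝ) = K * S'.card := by
    rw [Finset.card_eq_sum_card_fiberwise h2, Finset.sum_congr rfl hS']
    simp [mul_comm]
  have hN' : (N : ℝ) ≠ 0 := by positivity
  have hK' : (K : ℝ) ≠ 0 := by positivity
  have r1 : (∑ m ∈ S, g m) / (S.card : ℝ) = (∑ x ∈ E, g x.1) / E.card := by
    rw [e1, c1, mul_div_mul_left _ _ hN']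
  have r2 : (∑ m ∈ S', g m) / (S'.card : ℝ) = (∑ x ∈ E, g (φ x)) / E.card := by
    rw [e2, c2, mul_div_mul_left _ _ hK']
  rw [r1, r2, ← sub_div, ← Finset.sum_sub_distrib, abs_div, Nat.abs_cast]
  apply div_le_of_le_mul₀ (by positivity) hκ
  calc _ ≤ ∑ x ∈ E, |g (φ x) - g x.1| := Finset.abs_sum_le_sum_abs _ _
    _ ≤ ∑ x ∈ E, κ := Finset.sum_le_sum hg
    _ = _ := by simp [mul_comm]

/-- Pairs of the given type that can be added to the matching. -/
noncomputable def s7Free {H : Type} [Fintype H] (T : Sym2 H → Prop) (m : Finset (Sym2 H)) :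
    Finset (Sym2 H) :=
  Finset.univ.filter fun p => T p ∧ ¬ p.IsDiag ∧ ∀ h ∈ p, ∀ q ∈ m, h ∉ q

theorem s7_notMem {H : Type} [Fintype H] {T : Sym2 H → Prop} {m : Finset (Sym2 H)}
    {p : Sym2 H} (hp : p ∈ s7Free T m) : p ∉ m := by
  intro hm
  simp only [s7Free, Finset.mem_filter, Finset.mem_univ, true_and] at hp
  induction p with
  | _ x y => exact hp.2.2 x (by simp) _ hm (by simp)

theorem s7_insert {H : Type} {m : Finset (Sym2 H)} {p : Sym2 H} (hp : p ∉ m) :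
    IsPairMatching (insert p m) ↔
      IsPairMatching m ∧ ¬ p.IsDiag ∧ ∀ h ∈ p, ∀ q ∈ m, h ∉ q := by
  constructor
  · rintro ⟨h1, h2⟩
    refine ⟨⟨fun q hq => h1 q (by simp [hq]), fun q hq r hr => h2 q (by simp [hq]) r (by simp [hr])⟩,
      h1 p (by simp), fun h hh q hq => h2 p (by simp) q (by simp [hq]) ?_ h hh⟩
    rintro rfl; exact hp hq
  · rintro ⟨⟨h1, h2⟩, h3, h4⟩
    refine ⟨?_, ?_⟩
    · intro q hq
      rcases Finset.mem_insert.1 hq with rfl | hq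
      · exact h3
      · exact h1 q hq
    · intro q hq r hr hqr h hh
      rcases Finset.mem_insert.1 hq with hq' | hq' <;>
        rcases Finset.mem_insert.1 hr with hr' | hr'
      · exact absurd (hq'.trans hr'.symm) hqr
      · exact h4 h (hq' ▸ hh) r hr'
      · exact fun h' => h4 h (hr' ▸ h') q hq' hh
      · exact h2 q hq' r hr' hqr h hh

theorem s7_step {H : Type} [Fintype H] (T T2 T3 : Sym2 H → Prop)
    (hT2 : ∀ p, T p → ¬ T2 p) (hT3 : ∀ p, T p → ¬ T3 p) (a b c : ℕ)
    (S S' : Finset (Finset (Sym2 H)))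
    (hS : ∀ m, m ∈ S ↔ IsPairMatching m ∧ (m.filter T).card = a ∧ (m.filter T2).card = b ∧
      (m.filter T3).card = c)
    (hS' : ∀ m, m ∈ S' ↔ IsPairMatching m ∧ (m.filter T).card = a + 1 ∧
      (m.filter T2).card = b ∧ (m.filter T3).card = c)
    (g : Finset (Sym2 H) → ℝ) (κ : ℝ) (hκ : 0 ≤ κ) (N : ℕ) (hN : 0 < N)
    (hfree : ∀ m ∈ S, (s7Free T m).card = N)
    (hg : ∀ m p, p ∉ m → |g (insert p m) - g m| ≤ κ) :
    |(∑ m ∈ S', g m) / (S'.card : ℝ) - (∑ m ∈ S, g m) / (S.card : ℝ)| ≤ κ := by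
  have key : ∀ m p, T p → p ∉ m → (insert p m ∈ S' ↔ m ∈ S ∧ p ∈ s7Free T m) := by
    intro m p hp hpm
    rw [hS', hS, s7_insert hpm, Finset.filter_insert, Finset.filter_insert, Finset.filter_insert,
      if_pos hp, if_neg (hT2 p hp), if_neg (hT3 p hp), Finset.card_insert_of_notMem
        (fun h => hpm (Finset.mem_filter.1 h).1)]
    simp only [s7Free, Finset.mem_filter, Finset.mem_univ, true_and, add_left_inj]
    tauto
  have hTf : ∀ m p, p ∈ s7Free T m → T p := fun m p hp => (Finset.mem_filter.1 hp).2.1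
  refine s7_avg S S' (Finset.univ.filter fun x => x.1 ∈ S ∧ x.2 ∈ s7Free T x.1)
    (fun x => insert x.2 x.1) g κ hκ N (a + 1) hN (Nat.succ_pos _) ?_ ?_ ?_ ?_ ?_
  · rintro ⟨m, p⟩ hx
    exact (Finset.mem_filter.1 hx).2.1
  · rintro ⟨m, p⟩ hx
    have := (Finset.mem_filter.1 hx).2
    exact (key m p (hTf _ _ this.2) (s7_notMem this.2)).2 this
  · intro m hm
    rw [← hfree m hm]
    refine Finset.card_bij (fun x _ => x.2) ?_ ?_ ?_
    · rintro ⟨m', p⟩ hx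
      simp only [Finset.mem_filter, Finset.mem_univ, true_and] at hx
      obtain ⟨⟨_, h⟩, rfl⟩ := hx
      exact h
    · rintro ⟨m1, p1⟩ hx ⟨m2, p2⟩ hy h
      simp only [Finset.mem_filter] at hx hy
      simp only at h
      rw [Prod.mk.injEq]
      exact ⟨hx.2.trans hy.2.symm, h⟩
    · intro p hp
      exact ⟨(m, p), by simp [hm, hp], rfl⟩
  · intro m' hm'
    rw [← ((hS' m').1 hm').2.1]
    refine Finset.card_bij (fun x _ => x.2) ?_ ?_ ?_
    · rintro ⟨m, p⟩ hx
      simp only [Finset.mem_filter, Finset.mem_univ, true_and] at hx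
      obtain ⟨⟨_, h⟩, rfl⟩ := hx
      simp [hTf _ _ h]
    · rintro ⟨m1, p1⟩ hx ⟨m2, p2⟩ hy h
      simp only [Finset.mem_filter, Finset.mem_univ, true_and] at hx hy
      simp only at h
      subst h
      have n1 := s7_notMem hx.1.2
      have n2 := s7_notMem hy.1.2
      rw [Prod.mk.injEq]
      refine ⟨?_, rfl⟩
      rw [← Finset.erase_insert n1, ← Finset.erase_insert n2, hx.2, hy.2]
    · intro p hp
      obtain ⟨hpm, hpT⟩ := Finset.mem_filter.1 hp
      have hi := Finset.insert_erase hpm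
      have := (key (m'.erase p) p hpT (Finset.notMem_erase _ _)).1 (hi.symm ▸ hm')
      exact ⟨(m'.erase p, p), by
        simp only [Finset.mem_filter, Finset.mem_univ, true_and]
        exact ⟨this, hi⟩, rfl⟩
  · rintro ⟨m, p⟩ hx
    exact hg m p (s7_notMem (Finset.mem_filter.1 hx).2.2)

/-- Uncovered half-edges satisfying `P`. -/
noncomputable def s7U {H : Type} [Fintype H] (P : H → Prop) (m : Finset (Sym2 H)) : Finset H :=
  Finset.univ.filter fun h => P h ∧ ∀ q ∈ m, h ∉ q

theorem s7_count {H : Type} [Fintype H] (P Q : H → Prop) (hPQ : ∀ h, Q h ↔ ¬ P h)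
    (m : Finset (Sym2 H)) (hm : IsPairMatching m) :
    (s7U P m).card + 2 * (m.filter fun p => ∀ h ∈ p, P h).card +
      (m.filter fun p => (∃ h ∈ p, P h) ∧ ∃ h ∈ p, Q h).card =
      (Finset.univ.filter P).card := by
  have hcov : (m.biUnion fun p => p.toFinset.filter P).card =
      2 * (m.filter fun p => ∀ h ∈ p, P h).card +
      (m.filter fun p => (∃ h ∈ p, P h) ∧ ∃ h ∈ p, Q h).card := by
    rw [Finset.card_biUnion]
    · rw [Finset.card_filter, Finset.card_filter, Finset.mul_sum, ← Finset.sum_add_distrib]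
      refine Finset.sum_congr rfl fun p hp => ?_
      have hd := hm.1 p hp
      clear hp
      induction p with
      | _ x y =>
        have hxy : x ≠ y := by simpa using hd
        rw [Sym2.toFinset_mk_eq, Finset.filter_insert, Finset.filter_singleton]
        by_cases hx : P x <;> by_cases hy : P y <;> simp [hx, hy, hPQ, hxy]
    · intro p hp q hq hpq
      rw [Function.onFun, Finset.disjoint_left]
      intro h h1 h2
      simp only [Finset.mem_filter, Sym2.mem_toFinset] at h1 h2
      exact hm.2 p hp q hq hpq h h1.1 h2.1
  rw [add_assoc, ← hcov, ← Finset.card_union_of_disjoint]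
  · congr 1
    ext h
    simp only [s7U, Finset.mem_union, Finset.mem_filter, Finset.mem_univ, true_and,
      Finset.mem_biUnion, Sym2.mem_toFinset]
    constructor
    · rintro (h | ⟨q, _, _, h⟩)
      · exact h.1
      · exact h
    · intro hP
      by_cases hc : ∀ q ∈ m, h ∉ q
      · exact Or.inl ⟨hP, hc⟩
      · push Not at hc
        obtain ⟨q, hq, hh⟩ := hc
        exact Or.inr ⟨q, hq, hh, hP⟩
  · rw [Finset.disjoint_left]
    intro h h1 h2
    simp only [s7U, Finset.mem_filter, Finset.mem_univ, true_and,
      Finset.mem_biUnion, Sym2.mem_toFinset] at h1 h2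
    obtain ⟨q, hq, hh, _⟩ := h2
    exact h1.2 q hq hh

theorem s7_free_both {H : Type} [Fintype H] (P : H → Prop) (m : Finset (Sym2 H)) :
    (s7Free (fun p => ∀ h ∈ p, P h) m).card = (s7U P m).card.choose 2 := by
  rw [← Sym2.card_image_offDiag]
  congr 1
  ext p
  induction p with
  | _ x y =>
    simp only [s7Free, s7U, Finset.mem_filter, Finset.mem_univ, true_and, Finset.mem_image,
      Finset.mem_offDiag, Prod.exists, Sym2.mem_iff, forall_eq_or_imp, forall_eq,
      Sym2.mk_isDiag_iff]
    constructor
    · rintro ⟨⟨h1, h2⟩, h3, h4, h5⟩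
      exact ⟨x, y, ⟨⟨h1, h4⟩, ⟨h2, h5⟩, h3⟩, rfl⟩
    · rintro ⟨u, v, ⟨⟨h1, h4⟩, ⟨h2, h5⟩, h3⟩, h⟩
      rcases Sym2.eq_iff.1 h with ⟨rfl, rfl⟩ | ⟨rfl, rfl⟩
      · exact ⟨⟨h1, h2⟩, h3, h4, h5⟩
      · exact ⟨⟨h2, h1⟩, Ne.symm h3, h5, h4⟩

theorem s7_free_cross {H : Type} [Fintype H] (P Q : H → Prop) (hPQ : ∀ h, Q h ↔ ¬ P h)
    (m : Finset (Sym2 H)) :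
    (s7Free (fun p => (∃ h ∈ p, P h) ∧ ∃ h ∈ p, Q h) m).card =
      (s7U P m).card * (s7U Q m).card := by
  rw [← Finset.card_product]
  symm
  refine Finset.card_bij (fun x _ => s(x.1, x.2)) ?_ ?_ ?_
  · rintro ⟨x, y⟩ h
    simp only [s7Free, s7U, Finset.mem_filter, Finset.mem_univ, true_and, Finset.mem_product,
      Sym2.mem_iff, forall_eq_or_imp, forall_eq, Sym2.mk_isDiag_iff] at h ⊢
    refine ⟨⟨⟨x, Or.inl rfl, h.1.1⟩, ⟨y, Or.inr rfl, h.2.1⟩⟩, ?_, h.1.2, h.2.2⟩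
    rintro rfl
    exact (hPQ x).1 h.2.1 h.1.1
  · rintro ⟨x, y⟩ h ⟨u, v⟩ h' e
    simp only [s7U, Finset.mem_filter, Finset.mem_univ, true_and, Finset.mem_product] at h h'
    rcases Sym2.eq_iff.1 e with ⟨rfl, rfl⟩ | ⟨h1, h2⟩
    · rfl
    · simp only at h1 h2
      subst h1
      exact absurd h.1.1 ((hPQ _).1 h'.2.1)
  · intro p hp
    induction p with
    | _ x y =>
      simp only [s7Free, Finset.mem_filter, Finset.mem_univ, true_and,
        Sym2.mem_iff, forall_eq_or_imp, forall_eq, Sym2.mk_isDiag_iff, exists_eq_or_imp,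
        exists_eq_left, hPQ] at hp
      obtain ⟨⟨h1, h2⟩, h3, h4, h5⟩ := hp
      by_cases hx : P x
      · have hy : ¬ P y := by tauto
        exact ⟨(x, y), by simp [s7U, hPQ, hx, hy]; exact ⟨h4, h5⟩, rfl⟩
      · have hy : P y := by tauto
        exact ⟨(y, x), by simp [s7U, hPQ, hx, hy]; exact ⟨h5, h4⟩, Sym2.eq_swap⟩

theorem s7_mem_Mset (V : Type) [Fintype V] [DecidableEq V] (d : V → ℕ) (A B : Finset V)
    (a b c : ℕ) (m : Finset (Sym2 (HalfEdge V d))) :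
    m ∈ Mset V d A B a b c ↔ IsPairMatching m ∧
    (m.filter fun p => bothEnds A p).card = a ∧
    (m.filter fun p => bothEnds B p).card = b ∧
    (m.filter fun p => crossEnds A B p).card = c := by
  simp [Mset]

theorem s7_halfcard (V : Type) [Fintype V] (d : V → ℕ) (A : Finset V) :
    (Finset.univ.filter fun h : HalfEdge V d => h.1 ∈ A).card = ∑ i ∈ A, d i := by
  have : (Finset.univ.filter fun h : HalfEdge V d => h.1 ∈ A) =
      A.sigma fun i => (Finset.univ : Finset (Fin (d i))) := by
    ext ⟨i, s⟩; simp
  rw [this, Finset.card_sigma]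
  simp

theorem s7_cross_comm {V : Type} {d : V → ℕ} (A B : Finset V) :
    (crossEnds A B : Sym2 (HalfEdge V d) → Prop) = crossEnds B A := by
  funext p; exact propext and_comm

theorem s7_Mset_swap (V : Type) [Fintype V] [DecidableEq V] (d : V → ℕ) (A B : Finset V)
    (a b c : ℕ) : Mset V d A B a b c = Mset V d B A b a c := by
  ext m
  rw [s7_mem_Mset, s7_mem_Mset, s7_cross_comm A B]
  tauto

section
variable (f : Multigraph → ℝ) (κ : ℝ) (hlip : GraphParam.Lipschitz f κ)
    (V : Type) [Fintype V] [DecidableEq V] (d : V → ℕ)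

theorem s7_kappa (f : Multigraph → ℝ) (κ : ℝ) (hlip : GraphParam.Lipschitz f κ) : 0 ≤ κ :=
  (abs_nonneg _).trans (hlip { V := Unit, edges := 0 } () ())

theorem s7_lip (f : Multigraph → ℝ) (κ : ℝ) (hlip : GraphParam.Lipschitz f κ)
    (V : Type) [Fintype V] (d : V → ℕ) (m : Finset (Sym2 (HalfEdge V d)))
    (p : Sym2 (HalfEdge V d)) (hp : p ∉ m) :
    |f (matchingGraph V d (insert p m)) - f (matchingGraph V d m)| ≤ κ := by
  induction p with
  | _ x y =>
    have : matchingGraph V d (insert s(x, y) m) =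
        (matchingGraph V d m).addEdge (x.1 : V) (y.1 : V) := by
      simp [matchingGraph, Multigraph.addEdge, Finset.insert_val_of_notMem hp]
      rfl
    rw [this]
    exact hlip _ _ _

theorem s7_uncov (V : Type) [Fintype V] [DecidableEq V] (d : V → ℕ) (A B : Finset V)
    (hB : ∀ i, i ∈ B ↔ i ∉ A) (a b c : ℕ) (m : Finset (Sym2 (HalfEdge V d)))
    (hm : m ∈ Mset V d A B a b c) :
    (s7U (fun h : HalfEdge V d => h.1 ∈ A) m).card = (∑ i ∈ A, d i) - (2 * a + c) := by
  rw [s7_mem_Mset] at hm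
  have := s7_count (fun h : HalfEdge V d => h.1 ∈ A) (fun h => h.1 ∈ B) (fun h => hB h.1) m hm.1
  have hc := s7_halfcard V d A
  have h1 := hm.2.1
  have h3 := hm.2.2.2
  unfold bothEnds at h1
  unfold crossEnds at h3
  have key : (s7U (fun h : HalfEdge V d => h.1 ∈ A) m).card + 2 * a + c = ∑ i ∈ A, d i := by
    rw [← h1, ← h3, ← hc]
    convert this
  omega

theorem s7_both_not {V : Type} {d : V → ℕ} (A B : Finset V)
    (hB : ∀ i, i ∈ B ↔ i ∉ A) (p : Sym2 (HalfEdge V d)) (hp : bothEnds A p) :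
    ¬ bothEnds B p ∧ ¬ crossEnds A B p := by
  induction p with
  | _ x y =>
    simp only [bothEnds, crossEnds, Sym2.mem_iff, forall_eq_or_imp, forall_eq, exists_eq_or_imp,
      exists_eq_left, hB] at *
    tauto

theorem s7_stepA (f : Multigraph → ℝ) (κ : ℝ) (hlip : GraphParam.Lipschitz f κ)
    (V : Type) [Fintype V] [DecidableEq V] (d : V → ℕ) (A B : Finset V)
    (hB : ∀ i, i ∈ B ↔ i ∉ A) (a b c : ℕ) (hf : Feasible V d A B (a + 1) b c) :
    |Fav V d A B f (a + 1) b c - Fav V d A B f a b c| ≤ κ := by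
  refine s7_step (bothEnds A) (bothEnds B) (crossEnds A B)
    (fun p hp => (s7_both_not A B hB p hp).1) (fun p hp => (s7_both_not A B hB p hp).2) a b c
    _ _ (s7_mem_Mset V d A B a b c) (s7_mem_Mset V d A B (a + 1) b c)
    (fun m => f (matchingGraph V d m)) κ (s7_kappa f κ hlip)
    (((∑ i ∈ A, d i) - (2 * a + c)).choose 2) ?_ ?_
    (fun m p hp => by convert s7_lip f κ hlip V d m p hp)
  · apply Nat.choose_pos
    have := hf.1
    omega
  · intro m hm
    rw [← s7_uncov V d A B hB a b c m hm, ← s7_free_both]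
    rfl

theorem s7_stepB (f : Multigraph → ℝ) (κ : ℝ) (hlip : GraphParam.Lipschitz f κ)
    (V : Type) [Fintype V] [DecidableEq V] (d : V → ℕ) (A B : Finset V)
    (hB : ∀ i, i ∈ B ↔ i ∉ A) (a b c : ℕ) (hf : Feasible V d A B a (b + 1) c) :
    |Fav V d A B f a (b + 1) c - Fav V d A B f a b c| ≤ κ := by
  have := s7_stepA f κ hlip V d B A (fun i => by simp [hB]) b a c ⟨hf.2, hf.1⟩
  unfold Fav at *
  rwa [s7_Mset_swap V d A B, s7_Mset_swap V d A B]

theorem s7_stepC (f : Multigraph → ℝ) (κ : ℝ) (hlip : GraphParam.Lipschitz f κ)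
    (V : Type) [Fintype V] [DecidableEq V] (d : V → ℕ) (A B : Finset V)
    (hB : ∀ i, i ∈ B ↔ i ∉ A) (a b c : ℕ) (hf : Feasible V d A B a b (c + 1)) :
    |Fav V d A B f a b (c + 1) - Fav V d A B f a b c| ≤ κ := by
  have hA : ∀ i, i ∈ A ↔ i ∉ B := fun i => by simp [hB]
  refine s7_step (crossEnds A B) (bothEnds A) (bothEnds B)
    (fun p hp hp' => (s7_both_not A B hB p hp').2 hp)
    (fun p hp hp' => (s7_both_not B A hA p hp').2 (s7_cross_comm A B ▸ hp)) c a b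
    _ _ (fun m => (s7_mem_Mset V d A B a b c m).trans (by tauto))
    (fun m => (s7_mem_Mset V d A B a b (c + 1) m).trans (by tauto))
    (fun m => f (matchingGraph V d m)) κ (s7_kappa f κ hlip)
    (((∑ i ∈ A, d i) - (2 * a + c)) * ((∑ i ∈ B, d i) - (2 * b + c))) ?_ ?_
    (fun m p hp => by convert s7_lip f κ hlip V d m p hp)
  · have h1 := hf.1
    have h2 := hf.2
    apply Nat.mul_pos <;> omega
  · intro m hm
    rw [← s7_uncov V d A B hB a b c m hm, ← s7_uncov V d B A hA b a c m
      (by rwa [s7_Mset_swap]), 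
      ← s7_free_cross (fun h : HalfEdge V d => h.1 ∈ A) (fun h => h.1 ∈ B) (fun h => hB h.1)]
    rfl

end

theorem s7_line (F : ℕ → ℝ) (κ : ℝ) (x k : ℕ)
    (h : ∀ y, y + 1 ≤ x + k → |F (y + 1) - F y| ≤ κ) : |F (x + k) - F x| ≤ κ * k := by
  induction k with
  | zero => simp
  | succ k ih =>
    have h1 := ih fun y hy => h y (by omega)
    have h2 := h (x + k) (by omega)
    have := abs_sub_le (F (x + k + 1)) (F (x + k)) (F x)
    rw [← add_assoc]
    push_cast
    linarith

theorem s7_line' (F : ℕ → ℝ) (κ : ℝ) (x z : ℕ) (hxz : x ≤ z)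
    (h : ∀ y, y + 1 ≤ z → |F (y + 1) - F y| ≤ κ) : |F z - F x| ≤ κ * ((z : ℝ) - x) := by
  obtain ⟨k, rfl⟩ := Nat.exists_eq_add_of_le hxz
  have := s7_line F κ x k h
  push_cast
  simpa using this

theorem s7_down (f : Multigraph → ℝ) (κ : ℝ) (hlip : GraphParam.Lipschitz f κ)
    (V : Type) [Fintype V] [DecidableEq V] (d : V → ℕ) (A B : Finset V)
    (hB : ∀ i, i ∈ B ↔ i ∉ A) (a b c a' b' c' : ℕ) (hf : Feasible V d A B a b c)
    (ha : a' ≤ a) (hb : b' ≤ b) (hc : c' ≤ c) :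
    |Fav V d A B f a b c - Fav V d A B f a' b' c'| ≤
      κ * (((a : ℝ) - a') + ((b : ℝ) - b') + ((c : ℝ) - c')) := by
  obtain ⟨f1, f2⟩ := hf
  have h1 := s7_line' (fun x => Fav V d A B f x b c) κ a' a ha
    (fun y hy => s7_stepA f κ hlip V d A B hB y b c ⟨by omega, by omega⟩)
  have h2 := s7_line' (fun x => Fav V d A B f a' x c) κ b' b hb
    (fun y hy => s7_stepB f κ hlip V d A B hB a' y c ⟨by omega, by omega⟩)
  have h3 := s7_line' (fun x => Fav V d A B f a' b' x) κ c' c hc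
    (fun y hy => s7_stepC f κ hlip V d A B hB a' b' y ⟨by omega, by omega⟩)
  have t1 := abs_sub_le (Fav V d A B f a b c) (Fav V d A B f a' b c) (Fav V d A B f a' b' c')
  have t2 := abs_sub_le (Fav V d A B f a' b c) (Fav V d A B f a' b' c) (Fav V d A B f a' b' c')
  rw [mul_add, mul_add]
  linarith

theorem s7_abs_min (a a' : ℕ) :
    |(a : ℝ) - a'| = ((a : ℝ) - (min a a' : ℕ)) + ((a' : ℝ) - (min a a' : ℕ)) := by
  rcases le_total a a' with h | h
  · have : (a : ℝ) ≤ a' := by exact_mod_cast h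
    rw [min_eq_left h, abs_sub_comm, abs_of_nonneg (by linarith)]
    ring
  · have : (a' : ℝ) ≤ a := by exact_mod_cast h
    rw [min_eq_right h, abs_of_nonneg (by linarith)]
    ring

theorem statement7 (f : Multigraph → ℝ) (κ : ℝ)
    (hinv : GraphParam.Invariant f) (hlip : GraphParam.Lipschitz f κ)
    (V : Type) [Fintype V] [DecidableEq V] (A B : Finset V)
    (hAB : Disjoint A B) (hUnion : A ∪ B = Finset.univ) (d : V → ℕ)
    (a b c a' b' c' : ℕ)
    (h1 : Feasible V d A B a b c) (h2 : Feasible V d A B a' b' c') :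
    |Fav V d A B f a b c - Fav V d A B f a' b' c'| ≤
      κ * (|(a : ℝ) - (a' : ℝ)| + |(b : ℝ) - (b' : ℝ)| + |(c : ℝ) - (c' : ℝ)|) := by
  have hB : ∀ i, i ∈ B ↔ i ∉ A := by
    intro i
    have hu : i ∈ A ∪ B := hUnion ▸ Finset.mem_univ i
    rw [Finset.mem_union] at hu
    have hd : i ∈ A → i ∉ B := fun h => Finset.disjoint_left.1 hAB h
    tauto
  have d1 := s7_down f κ hlip V d A B hB a b c (min a a') (min b b') (min c c') h1
    (min_le_left _ _) (min_le_left _ _) (min_le_left _ _)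
  have d2 := s7_down f κ hlip V d A B hB a' b' c' (min a a') (min b b') (min c c') h2
    (min_le_right _ _) (min_le_right _ _) (min_le_right _ _)
  rw [abs_sub_comm] at d2
  have t := abs_sub_le (Fav V d A B f a b c)
    (Fav V d A B f (min a a') (min b b') (min c c')) (Fav V d A B f a' b' c')
  rw [s7_abs_min a a', s7_abs_min b b', s7_abs_min c c']
  refine t.trans ((add_le_add d1 d2).trans (le_of_eq ?_))
  ring
end

section
/- Let 𝔣 be a κ-Lipschitz, concave graph parameter, let V = A ∪ B be a finite set partitioned into disjoint sets A and B, and let d : V → ℕ. Then for any integer δ ≥ 2 and any (α, β, γ) ∈ ℕ³ such that the triple (α, β, γ + δ) is feasible, (F(α+1, β, γ) + F(α, β+1, γ))/2 ≤ F(α, β, γ+1) + 2κ/δ. -/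
open Finset Filter Topology MeasureTheory
open scoped Classical BigOperators ENNReal

noncomputable def freeH (V : Type) [Fintype V] [DecidableEq V] (d : V → ℕ)
    (m : Finset (Sym2 (HalfEdge V d))) (X : Finset V) : Finset (HalfEdge V d) :=
  Finset.univ.filter fun h => h.1 ∈ X ∧ ∀ p ∈ m, h ∉ p

noncomputable def darts (V : Type) [Fintype V] [DecidableEq V] (d : V → ℕ)
    (m : Finset (Sym2 (HalfEdge V d))) (X Y : Finset V) :
    Finset (HalfEdge V d × HalfEdge V d) :=
  Finset.univ.filter fun q => s(q.1, q.2) ∈ m ∧ q.1.1 ∈ X ∧ q.2.1 ∈ Y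

noncomputable def newD (V : Type) [Fintype V] [DecidableEq V] (d : V → ℕ)
    (m : Finset (Sym2 (HalfEdge V d))) (X Y : Finset V) :
    Finset (HalfEdge V d × HalfEdge V d) :=
  (freeH V d m X ×ˢ freeH V d m Y).filter fun q => q.1 ≠ q.2

section helpers
variable {V : Type} [Fintype V] [DecidableEq V] {d : V → ℕ}

theorem mem_freeH {m : Finset (Sym2 (HalfEdge V d))} {X : Finset V} {h : HalfEdge V d} :
    h ∈ freeH V d m X ↔ h.1 ∈ X ∧ ∀ p ∈ m, h ∉ p := by
  simp [freeH]

theorem mem_darts {m : Finset (Sym2 (HalfEdge V d))} {X Y : Finset V}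
    {q : HalfEdge V d × HalfEdge V d} :
    q ∈ darts V d m X Y ↔ s(q.1, q.2) ∈ m ∧ q.1.1 ∈ X ∧ q.2.1 ∈ Y := by
  simp [darts]

theorem mem_newD {m : Finset (Sym2 (HalfEdge V d))} {X Y : Finset V}
    {q : HalfEdge V d × HalfEdge V d} :
    q ∈ newD V d m X Y ↔ (q.1 ∈ freeH V d m X ∧ q.2 ∈ freeH V d m Y) ∧ q.1 ≠ q.2 := by
  simp [newD]

theorem notMem_of_free {m : Finset (Sym2 (HalfEdge V d))} {X : Finset V} {h k : HalfEdge V d}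
    (hh : h ∈ freeH V d m X) : s(h, k) ∉ m := by
  intro hm
  exact (mem_freeH.1 hh).2 _ hm (Sym2.mem_mk_left _ _)

theorem matching_insert {m : Finset (Sym2 (HalfEdge V d))} {X Y : Finset V} {h k : HalfEdge V d}
    (hm : IsPairMatching m) (hh : h ∈ freeH V d m X) (hk : k ∈ freeH V d m Y) (hne : h ≠ k) :
    IsPairMatching (insert s(h, k) m) := by
  rw [mem_freeH] at hh hk
  refine ⟨?_, ?_⟩
  · intro p hp
    rcases Finset.mem_insert.1 hp with rfl | hp
    · simpa using hne
    · exact hm.1 p hp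
  · intro p hp q hq hpq x hx hxq
    rcases Finset.mem_insert.1 hp with rfl | hp' <;> rcases Finset.mem_insert.1 hq with rfl | hq'
    · exact hpq rfl
    · rcases Sym2.mem_iff.1 hx with rfl | rfl
      · exact hh.2 _ hq' hxq
      · exact hk.2 _ hq' hxq
    · rcases Sym2.mem_iff.1 hxq with rfl | rfl
      · exact hh.2 _ hp' hx
      · exact hk.2 _ hp' hx
    · exact hm.2 p hp' q hq' hpq x hx hxq

theorem matching_erase {m : Finset (Sym2 (HalfEdge V d))} {p : Sym2 (HalfEdge V d)}
    (hm : IsPairMatching m) : IsPairMatching (m.erase p) :=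
  ⟨fun q hq => hm.1 q (Finset.mem_of_mem_erase hq),
    fun q hq r hr => hm.2 q (Finset.mem_of_mem_erase hq) r (Finset.mem_of_mem_erase hr)⟩

theorem double_count (M M' : Finset (Finset (Sym2 (HalfEdge V d)))) (X Y : Finset V)
    (g : Finset (Sym2 (HalfEdge V d)) → ℝ) (N : ℕ)
    (h1' : ∀ m ∈ M', IsPairMatching m)
    (hins : ∀ m ∈ M, ∀ q ∈ newD V d m X Y, insert s(q.1, q.2) m ∈ M')
    (her : ∀ m ∈ M', ∀ q ∈ darts V d m X Y, m.erase s(q.1, q.2) ∈ M)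
    (hN : ∀ m ∈ M', (darts V d m X Y).card = N) :
    ∑ m ∈ M, ∑ q ∈ newD V d m X Y, g (insert s(q.1, q.2) m) = N * ∑ m ∈ M', g m := by
  have : (N : ℝ) * ∑ m ∈ M', g m = ∑ m ∈ M', ∑ q ∈ darts V d m X Y, g m := by
    rw [Finset.mul_sum]
    refine Finset.sum_congr rfl fun m hm => ?_
    rw [Finset.sum_const, hN m hm, nsmul_eq_mul]
  rw [this, Finset.sum_sigma', Finset.sum_sigma']
  refine Finset.sum_bij' (fun z _ => ⟨insert s(z.2.1, z.2.2) z.1, z.2⟩)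
    (fun z _ => ⟨z.1.erase s(z.2.1, z.2.2), z.2⟩) ?_ ?_ ?_ ?_ ?_
  · rintro ⟨m, q⟩ hz
    rw [Finset.mem_sigma] at hz ⊢
    refine ⟨hins m hz.1 q hz.2, ?_⟩
    have := mem_newD.1 hz.2
    exact mem_darts.2 ⟨Finset.mem_insert_self _ _, (mem_freeH.1 this.1.1).1,
      (mem_freeH.1 this.1.2).1⟩
  · rintro ⟨m, q⟩ hz
    rw [Finset.mem_sigma] at hz ⊢
    refine ⟨her m hz.1 q hz.2, ?_⟩
    have hm := h1' m hz.1
    have hq := mem_darts.1 hz.2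
    refine mem_newD.2 ⟨⟨mem_freeH.2 ⟨hq.2.1, ?_⟩, mem_freeH.2 ⟨hq.2.2, ?_⟩⟩, ?_⟩
    · intro p hp
      exact hm.2 _ hq.1 p (Finset.mem_of_mem_erase hp) (Finset.ne_of_mem_erase hp).symm _
        (Sym2.mem_mk_left _ _)
    · intro p hp
      exact hm.2 _ hq.1 p (Finset.mem_of_mem_erase hp) (Finset.ne_of_mem_erase hp).symm _
        (Sym2.mem_mk_right _ _)
    · have := hm.1 _ hq.1
      simpa using this
  · rintro ⟨m, q⟩ hz
    rw [Finset.mem_sigma] at hz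
    have := mem_newD.1 hz.2
    simp [Finset.erase_insert (notMem_of_free (k := q.2) this.1.1)]
  · rintro ⟨m, q⟩ hz
    rw [Finset.mem_sigma] at hz
    have := mem_darts.1 hz.2
    simp [Finset.insert_erase this.1]
  · rintro ⟨m, q⟩ hz
    rfl

theorem darts_card_both {m : Finset (Sym2 (HalfEdge V d))} (hm : IsPairMatching m)
    (X : Finset V) :
    (darts V d m X X).card = 2 * (m.filter fun p => bothEnds X p).card := by
  rw [Finset.card_eq_sum_card_fiberwise (f := fun q : HalfEdge V d × HalfEdge V d => s(q.1, q.2))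
    (t := m.filter fun p => bothEnds X p)]
  · rw [Finset.sum_const_nat (m := 2), mul_comm]
    intro p hp
    rw [Finset.mem_filter] at hp
    have hd := hm.1 p hp.1
    induction p using Sym2.ind with
    | _ x y =>
      have hxy : x ≠ y := by simpa using hd
      have hx : x.1 ∈ X := hp.2 x (Sym2.mem_mk_left _ _)
      have hy : y.1 ∈ X := hp.2 y (Sym2.mem_mk_right _ _)
      have : (darts V d m X X).filter (fun q => s(q.1, q.2) = s(x, y)) = {(x, y), (y, x)} := by
        ext ⟨u, v⟩
        simp only [Finset.mem_filter, mem_darts, Finset.mem_insert, Finset.mem_singleton,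
          Prod.mk.injEq, Sym2.eq_iff]
        constructor
        · exact fun h => h.2
        · rintro (⟨rfl, rfl⟩ | ⟨rfl, rfl⟩)
          · exact ⟨⟨hp.1, hx, hy⟩, Or.inl ⟨rfl, rfl⟩⟩
          · exact ⟨⟨by rw [Sym2.eq_swap]; exact hp.1, hy, hx⟩, Or.inr ⟨rfl, rfl⟩⟩
      rw [this, Finset.card_pair]
      simp [hxy]
  · intro q hq
    have hq := mem_darts.1 (Finset.mem_coe.1 hq)
    refine Finset.mem_coe.2 (Finset.mem_filter.2 ⟨hq.1, ?_⟩)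
    intro h hh
    rcases Sym2.mem_iff.1 hh with rfl | rfl
    · exact hq.2.1
    · exact hq.2.2

theorem darts_card_cross (m : Finset (Sym2 (HalfEdge V d)))
    {X Y : Finset V} (hXY : Disjoint X Y) :
    (darts V d m X Y).card = (m.filter fun p => crossEnds X Y p).card := by
  refine Finset.card_bij (fun q _ => s(q.1, q.2)) ?_ ?_ ?_
  · intro q hq
    have hq := mem_darts.1 hq
    exact Finset.mem_filter.2 ⟨hq.1, ⟨_, Sym2.mem_mk_left _ _, hq.2.1⟩,
      ⟨_, Sym2.mem_mk_right _ _, hq.2.2⟩⟩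
  · rintro ⟨u, v⟩ hq ⟨u', v'⟩ hq' h
    have hq := mem_darts.1 hq
    have hq' := mem_darts.1 hq'
    rcases Sym2.eq_iff.1 h with ⟨h1, h2⟩ | ⟨h1, h2⟩
    · exact Prod.ext h1 h2
    · simp only at h1 h2 hq hq'
      subst h1 h2
      exact absurd hq'.2.2 (Finset.disjoint_left.1 hXY hq.2.1)
  · intro p hp
    rw [Finset.mem_filter] at hp
    obtain ⟨hp, ⟨x, hx, hxX⟩, ⟨y, hy, hyY⟩⟩ := hp
    have hne : x ≠ y := by
      rintro rfl
      exact Finset.disjoint_left.1 hXY hxX hyY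
    have : p = s(x, y) := (Sym2.mem_and_mem_iff hne).1 ⟨hx, hy⟩
    exact ⟨(x, y), mem_darts.2 ⟨this ▸ hp, hxX, hyY⟩, this.symm⟩

theorem card_half (X : Finset V) :
    (Finset.univ.filter fun h : HalfEdge V d => h.1 ∈ X).card = ∑ i ∈ X, d i := by
  have : (Finset.univ.filter fun h : HalfEdge V d => h.1 ∈ X)
      = X.sigma (fun i => (Finset.univ : Finset (Fin (d i)))) := by
    ext h; simp
  rw [this, Finset.card_sigma]; simp

theorem card_free {m : Finset (Sym2 (HalfEdge V d))} (hm : IsPairMatching m)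
    {X Y : Finset V} (hXY : Disjoint X Y) (hU : X ∪ Y = Finset.univ) :
    (freeH V d m X).card + (2 * (m.filter fun p => bothEnds X p).card
      + (m.filter fun p => crossEnds X Y p).card) = ∑ i ∈ X, d i := by
  rw [← darts_card_both hm, ← darts_card_cross m hXY, ← card_half (d := d) X]
  have hdj : Disjoint (darts V d m X X) (darts V d m X Y) := by
    rw [Finset.disjoint_left]
    intro q h1 h2
    exact Finset.disjoint_left.1 hXY (mem_darts.1 h1).2.2 (mem_darts.1 h2).2.2
  rw [← Finset.card_union_of_disjoint hdj]
  have himg : (darts V d m X X ∪ darts V d m X Y).card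
      = (Finset.univ.filter fun h : HalfEdge V d => h.1 ∈ X ∧ ¬ ∀ p ∈ m, h ∉ p).card := by
    refine Finset.card_bij (fun q _ => q.1) ?_ ?_ ?_
    · intro q hq
      have : s(q.1, q.2) ∈ m ∧ q.1.1 ∈ X := by
        rcases Finset.mem_union.1 hq with h | h
        · exact ⟨(mem_darts.1 h).1, (mem_darts.1 h).2.1⟩
        · exact ⟨(mem_darts.1 h).1, (mem_darts.1 h).2.1⟩
      refine Finset.mem_filter.2 ⟨Finset.mem_univ _, this.2, ?_⟩
      intro h
      exact h _ this.1 (Sym2.mem_mk_left _ _)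
    · rintro ⟨u, v⟩ hq ⟨u', v'⟩ hq' h
      simp only at h
      subst h
      have h1 : s(u, v) ∈ m := by
        rcases Finset.mem_union.1 hq with h | h <;> exact (mem_darts.1 h).1
      have h2 : s(u, v') ∈ m := by
        rcases Finset.mem_union.1 hq' with h | h <;> exact (mem_darts.1 h).1
      by_contra hne
      have hne' : s(u, v) ≠ s(u, v') := by
        intro h
        exact hne (by rw [Sym2.congr_right.1 h])
      exact hm.2 _ h1 _ h2 hne' u (Sym2.mem_mk_left _ _) (Sym2.mem_mk_left _ _)
    · intro h hh
      obtain ⟨-, hX, hh⟩ := Finset.mem_filter.1 hh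
      push Not at hh
      obtain ⟨p, hp, hhp⟩ := hh
      obtain ⟨k, rfl⟩ := Sym2.mem_iff_exists.1 hhp
      have hk : k.1 ∈ X ∪ Y := by rw [hU]; exact Finset.mem_univ _
      refine ⟨(h, k), ?_, rfl⟩
      rcases Finset.mem_union.1 hk with hk | hk
      · exact Finset.mem_union_left _ (mem_darts.2 ⟨hp, hX, hk⟩)
      · exact Finset.mem_union_right _ (mem_darts.2 ⟨hp, hX, hk⟩)
  rw [himg, freeH, ← Finset.filter_filter, ← Finset.filter_filter]
  exact Finset.card_filter_add_card_filter_not _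

theorem graph_insert {m : Finset (Sym2 (HalfEdge V d))} {h k : HalfEdge V d}
    (hn : s(h, k) ∉ m) :
    matchingGraph V d (insert s(h, k) m) = (matchingGraph V d m).addEdge h.1 k.1 := by
  have : (insert s(h, k) m).val.map (Sym2.map Sigma.fst)
      = s(h.1, k.1) ::ₘ m.val.map (Sym2.map Sigma.fst) := by
    rw [Finset.insert_val_of_notMem hn]
    simp
  simp only [matchingGraph, this]
  rfl

theorem conc_half {H : Type} [Fintype H] (D : V → V → ℝ) (π : H → V)
    (hD : ∀ x : V → ℝ, ∑ i, x i = 0 → ∑ i, ∑ j, D i j * x i * x j ≤ 0)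
    (w : H → ℝ) (hw : ∑ h, w h = 0) :
    ∑ h, ∑ k, D (π h) (π k) * w h * w k ≤ 0 := by
  have key : ∀ φ : V → ℝ, ∑ i, φ i * (∑ h, if π h = i then w h else 0)
      = ∑ h, φ (π h) * w h := by
    intro φ
    simp_rw [Finset.mul_sum]
    rw [Finset.sum_comm]
    refine Finset.sum_congr rfl fun h _ => ?_
    simp
  have h0 := hD (fun i => ∑ h, if π h = i then w h else 0) (by
    have := key (fun _ => 1)
    simp only [one_mul] at this
    rw [this, hw])
  refine le_of_eq_of_le ?_ h0
  symm
  calc _ = ∑ i, (∑ k, D i (π k) * w k) * (∑ h, if π h = i then w h else 0) := by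
        refine Finset.sum_congr rfl fun i _ => ?_
        rw [← key (D i), Finset.sum_mul]
        refine Finset.sum_congr rfl fun j _ => ?_
        ring
    _ = ∑ h, (∑ k, D (π h) (π k) * w k) * w h := key (fun i => ∑ k, D i (π k) * w k)
    _ = _ := by
        refine Finset.sum_congr rfl fun i _ => ?_
        rw [Finset.sum_mul]
        refine Finset.sum_congr rfl fun j _ => ?_
        ring

theorem conc_two {H : Type} [Fintype H] (E : H → H → ℝ) (hsym : ∀ h k, E h k = E k h)
    (hE : ∀ w : H → ℝ, ∑ h, w h = 0 → ∑ h, ∑ k, E h k * w h * w k ≤ 0)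
    (P R : Finset H) (S T : ℝ) (hS : (P.card : ℝ) = S) (hT : (R.card : ℝ) = T)
    (hS0 : 0 < S) (hT0 : 0 < T) :
    (∑ h ∈ P, ∑ k ∈ P, E h k) / (S * S) + (∑ h ∈ R, ∑ k ∈ R, E h k) / (T * T)
      ≤ 2 * ((∑ h ∈ P, ∑ k ∈ R, E h k) / (S * T)) := by
  have h0 := hE (fun h => (if h ∈ P then S⁻¹ else 0) - (if h ∈ R then T⁻¹ else 0)) (by
    rw [Finset.sum_sub_distrib]
    simp [hS, hT, hS0.ne', hT0.ne'])
  have key : ∀ (A B : Finset H) (s t : ℝ),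
      ∑ h, ∑ k, E h k * (if h ∈ A then s else 0) * (if k ∈ B then t else 0)
        = (∑ h ∈ A, ∑ k ∈ B, E h k) * (s * t) := by
    intro A B s t
    simp only [mul_ite, mul_zero, ite_mul, zero_mul, Finset.sum_ite_mem, Finset.univ_inter,
      Finset.sum_mul]
    rw [← Finset.sum_filter_add_sum_filter_not Finset.univ (fun h => h ∈ A)]
    rw [Finset.sum_eq_zero (s := Finset.univ.filter fun h => ¬ h ∈ A), add_zero]
    · rw [Finset.filter_univ_mem]
      refine Finset.sum_congr rfl fun h hh => Finset.sum_congr rfl fun k _ => ?_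
      simp [hh, mul_assoc]
    · intro h hh
      simp [(Finset.mem_filter.1 hh).2]
  have hexp : ∑ h, ∑ k, E h k * ((if h ∈ P then S⁻¹ else 0) - (if h ∈ R then T⁻¹ else 0))
        * ((if k ∈ P then S⁻¹ else 0) - (if k ∈ R then T⁻¹ else 0))
      = (∑ h ∈ P, ∑ k ∈ P, E h k) * (S⁻¹ * S⁻¹) - (∑ h ∈ P, ∑ k ∈ R, E h k) * (S⁻¹ * T⁻¹)
        - (∑ h ∈ R, ∑ k ∈ P, E h k) * (T⁻¹ * S⁻¹) + (∑ h ∈ R, ∑ k ∈ R, E h k) * (T⁻¹ * T⁻¹) := by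
    rw [← key, ← key, ← key, ← key]
    simp only [← Finset.sum_sub_distrib, ← Finset.sum_add_distrib]
    refine Finset.sum_congr rfl fun h _ => Finset.sum_congr rfl fun k _ => ?_
    ring
  have hsw : ∑ h ∈ R, ∑ k ∈ P, E h k = ∑ h ∈ P, ∑ k ∈ R, E h k := by
    rw [Finset.sum_comm]
    exact Finset.sum_congr rfl fun h _ => Finset.sum_congr rfl fun k _ => hsym _ _
  rw [hexp, hsw] at h0
  simp only [div_eq_mul_inv, mul_inv]
  have : T⁻¹ * S⁻¹ = S⁻¹ * T⁻¹ := mul_comm _ _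
  rw [this] at h0
  linarith

/-- Passing from pairs with replacement to pairs without replacement. -/
theorem no_repl {H : Type} (E : H → H → ℝ) (κ : ℝ) (hκ : ∀ h k, |E h k| ≤ κ)
    (P : Finset H) (S δ : ℝ) (hS : (P.card : ℝ) = S) (hδ : 2 ≤ δ) (hSδ : δ ≤ S) (hκ0 : 0 ≤ κ) :
    (∑ q ∈ (P ×ˢ P).filter (fun q => q.1 ≠ q.2), E q.1 q.2) / (S * (S - 1))
      ≤ (∑ h ∈ P, ∑ k ∈ P, E h k) / (S * S) + 2 * κ / δ := by
  have hcard : (((P ×ˢ P).filter (fun q => q.1 ≠ q.2)).card : ℝ) = S * (S - 1) := by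
    have := Finset.offDiag_card P
    have h2 : (P ×ˢ P).filter (fun q => q.1 ≠ q.2) = P.offDiag := by
      ext q; simp [Finset.mem_offDiag, and_assoc]
    rw [h2, this, Nat.cast_sub (Nat.le_mul_self _), Nat.cast_mul, hS]; ring
  set O := ∑ q ∈ (P ×ˢ P).filter (fun q => q.1 ≠ q.2), E q.1 q.2 with hO
  have hOb : O ≤ S * (S - 1) * κ := by
    rw [← hcard, ← nsmul_eq_mul]
    exact Finset.sum_le_card_nsmul _ _ _ fun q _ => (le_abs_self _).trans (hκ _ _)
  have hdec : ∑ h ∈ P, ∑ k ∈ P, E h k = O + ∑ h ∈ P, E h h := by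
    rw [← Finset.sum_product', ← Finset.sum_filter_not_add_sum_filter (P ×ˢ P)
      (fun q => q.1 = q.2)]
    congr 1
    refine (Finset.sum_bij (fun h _ => (h, h)) ?_ ?_ ?_ ?_).symm
    · intro h hh; simp [hh]
    · intro h _ k _ hk; exact (Prod.ext_iff.1 hk).1
    · rintro ⟨h, k⟩ hk
      simp only [Finset.mem_filter, Finset.mem_product] at hk
      obtain ⟨⟨h1, _⟩, rfl⟩ := hk
      exact ⟨h, h1, rfl⟩
    · intro h _; rfl
  have hdiag : -(S * κ) ≤ ∑ h ∈ P, E h h := by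
    have : P.card • (-κ) ≤ ∑ h ∈ P, E h h :=
      Finset.card_nsmul_le_sum _ _ _ fun h _ => (abs_le.1 (hκ h h)).1
    rw [nsmul_eq_mul, hS] at this
    linarith
  have hSp : 0 < S := by linarith
  have hS1 : 0 < S - 1 := by linarith
  have h1 : O / (S * (S - 1)) ≤ κ := by
    rw [div_le_iff₀ (by positivity)]; linarith
  have h2 : (∑ h ∈ P, ∑ k ∈ P, E h k) / (S * S)
      = O / (S * (S - 1)) - O / (S * (S - 1)) / S + (∑ h ∈ P, E h h) / (S * S) := by
    rw [hdec]; field_simp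
  have h3 : -(κ / S) ≤ (∑ h ∈ P, E h h) / (S * S) := by
    rw [le_div_iff₀ (by positivity)]
    have : -(κ / S) * (S * S) = -(S * κ) := by field_simp
    linarith
  have h4 : O / (S * (S - 1)) / S ≤ κ / S := by gcongr
  have h5 : κ / S ≤ κ / δ := by gcongr
  have h6 : 2 * κ / δ = κ / δ + κ / δ := by ring
  rw [h2, h6]; linarith

theorem mem_Mset {A B : Finset V} {a b c : ℕ} {m : Finset (Sym2 (HalfEdge V d))} :
    m ∈ Mset V d A B a b c ↔ IsPairMatching m ∧
    (m.filter fun p => bothEnds A p).card = a ∧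
    (m.filter fun p => bothEnds B p).card = b ∧
    (m.filter fun p => crossEnds A B p).card = c := by
  simp [Mset]

theorem card_filter_ins {m : Finset (Sym2 (HalfEdge V d))} {p : Sym2 (HalfEdge V d)}
    (hp : p ∉ m) (Q : Sym2 (HalfEdge V d) → Prop) :
    ((insert p m).filter Q).card = (m.filter Q).card + if Q p then 1 else 0 := by
  rw [Finset.filter_insert]
  split_ifs with h
  · rw [Finset.card_insert_of_notMem]
    simp [hp]
  · rfl

theorem card_filter_er {m : Finset (Sym2 (HalfEdge V d))} {p : Sym2 (HalfEdge V d)}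
    (hp : p ∈ m) (Q : Sym2 (HalfEdge V d) → Prop) :
    ((m.erase p).filter Q).card + (if Q p then 1 else 0) = (m.filter Q).card := by
  rw [← card_filter_ins (Finset.notMem_erase p m) Q, Finset.insert_erase hp]

theorem bothEnds_mk {X : Finset V} {h k : HalfEdge V d} :
    bothEnds X s(h, k) ↔ h.1 ∈ X ∧ k.1 ∈ X := by
  simp [bothEnds]

theorem crossEnds_mk {X Y : Finset V} {h k : HalfEdge V d} :
    crossEnds X Y s(h, k) ↔ (h.1 ∈ X ∨ k.1 ∈ X) ∧ (h.1 ∈ Y ∨ k.1 ∈ Y) := by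
  simp [crossEnds]

/-- The average over the larger matchings as an average over one-edge extensions. -/
theorem Fav_eq (A B X Y : Finset V) (f : Multigraph → ℝ) (a b c a' b' c' N : ℕ) (K : ℝ)
    (hN0 : N ≠ 0)
    (ht : ∀ h k : HalfEdge V d, h.1 ∈ X → k.1 ∈ Y →
      (a + if bothEnds A s(h, k) then 1 else 0) = a' ∧
      (b + if bothEnds B s(h, k) then 1 else 0) = b' ∧
      (c + if crossEnds A B s(h, k) then 1 else 0) = c')
    (hN : ∀ m ∈ Mset V d A B a' b' c', (darts V d m X Y).card = N)
    (hK : ∀ m ∈ Mset V d A B a b c, ((newD V d m X Y).card : ℝ) = K) :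
    Fav V d A B f a' b' c' = (∑ m ∈ Mset V d A B a b c,
      (∑ q ∈ newD V d m X Y, f ((matchingGraph V d m).addEdge q.1.1 q.2.1)) / K)
        / (Mset V d A B a b c).card := by
  have hdc := fun g => double_count (Mset V d A B a b c) (Mset V d A B a' b' c') X Y g N
    (fun m hm => (mem_Mset.1 hm).1)
    (by
      intro m hm q hq
      obtain ⟨h1, h2, h3, h4⟩ := mem_Mset.1 hm
      obtain ⟨⟨hq1, hq2⟩, hq3⟩ := mem_newD.1 hq
      have hn := notMem_of_free (k := q.2) hq1
      obtain ⟨t1, t2, t3⟩ := ht q.1 q.2 (mem_freeH.1 hq1).1 (mem_freeH.1 hq2).1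
      refine mem_Mset.2 ⟨matching_insert h1 hq1 hq2 hq3, ?_, ?_, ?_⟩
      · rw [card_filter_ins hn, h2, t1]
      · rw [card_filter_ins hn, h3, t2]
      · rw [card_filter_ins hn, h4, t3])
    (by
      intro m hm q hq
      obtain ⟨h1, h2, h3, h4⟩ := mem_Mset.1 hm
      obtain ⟨hq1, hq2, hq3⟩ := mem_darts.1 hq
      obtain ⟨t1, t2, t3⟩ := ht q.1 q.2 hq2 hq3
      refine mem_Mset.2 ⟨matching_erase h1, ?_, ?_, ?_⟩
      · have := card_filter_er hq1 (fun p => bothEnds A p)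
        rw [h2, ← t1] at this
        exact Nat.add_right_cancel this
      · have := card_filter_er hq1 (fun p => bothEnds B p)
        rw [h3, ← t2] at this
        exact Nat.add_right_cancel this
      · have := card_filter_er hq1 (fun p => crossEnds A B p)
        rw [h4, ← t3] at this
        exact Nat.add_right_cancel this) hN
  have hf := hdc (fun m => f (matchingGraph V d m))
  have h1 := hdc (fun _ => 1)
  simp only [Finset.sum_const, nsmul_eq_mul, mul_one] at h1
  rw [Finset.sum_congr rfl hK, Finset.sum_const, nsmul_eq_mul] at h1
  have hN1 : (N : ℝ) ≠ 0 := by exact_mod_cast hN0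
  rw [Fav, ← mul_div_mul_left _ _ hN1, ← hf, ← h1, ← Finset.sum_div, div_div, mul_comm K]
  congr 1
  refine Finset.sum_congr rfl fun m hm => Finset.sum_congr rfl fun q hq => ?_
  rw [graph_insert (notMem_of_free (k := q.2) (mem_newD.1 hq).1.1)]

theorem newD_card_same {m : Finset (Sym2 (HalfEdge V d))} (X : Finset V) :
    ((newD V d m X X).card : ℝ)
      = ((freeH V d m X).card : ℝ) * ((freeH V d m X).card - 1) := by
  have h2 : newD V d m X X = (freeH V d m X).offDiag := by
    ext q; simp [mem_newD, Finset.mem_offDiag, and_assoc]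
  rw [h2, Finset.offDiag_card, Nat.cast_sub (Nat.le_mul_self _), Nat.cast_mul]; ring

theorem newD_cross {m : Finset (Sym2 (HalfEdge V d))} {X Y : Finset V} (hXY : Disjoint X Y) :
    newD V d m X Y = freeH V d m X ×ˢ freeH V d m Y := by
  rw [newD, Finset.filter_true_of_mem]
  intro q hq heq
  rw [Finset.mem_product, ← heq] at hq
  exact Finset.disjoint_left.1 hXY (mem_freeH.1 hq.1).1 (mem_freeH.1 hq.2).1

/-- The pointwise inequality for a fixed matching. -/
theorem pointwise (f : Multigraph → ℝ) (κ : ℝ) (hlip : GraphParam.Lipschitz f κ)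
    (hconc : GraphParam.Concave f) (A B : Finset V) (hAB : Disjoint A B)
    (m : Finset (Sym2 (HalfEdge V d))) (S T δ : ℝ) (hδ : 2 ≤ δ)
    (hS : ((freeH V d m A).card : ℝ) = S) (hT : ((freeH V d m B).card : ℝ) = T)
    (hSδ : δ ≤ S) (hTδ : δ ≤ T) (hκ0 : 0 ≤ κ) :
    ((∑ q ∈ newD V d m A A, f ((matchingGraph V d m).addEdge q.1.1 q.2.1)) / (S * (S - 1))
      + (∑ q ∈ newD V d m B B, f ((matchingGraph V d m).addEdge q.1.1 q.2.1)) / (T * (T - 1))) / 2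
    ≤ (∑ q ∈ newD V d m A B, f ((matchingGraph V d m).addEdge q.1.1 q.2.1)) / (S * T)
      + 2 * κ / δ := by
  set G := matchingGraph V d m with hG
  set E : HalfEdge V d → HalfEdge V d → ℝ := fun h k => f (G.addEdge h.1 k.1) - f G with hE
  have hsub : ∀ Q : Finset (HalfEdge V d × HalfEdge V d),
      ∑ q ∈ Q, f (G.addEdge q.1.1 q.2.1) = ∑ q ∈ Q, E q.1 q.2 + Q.card * f G := by
    intro Q
    simp only [hE, Finset.sum_sub_distrib, Finset.sum_const, nsmul_eq_mul]
    ring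
  have hlipE : ∀ h k, |E h k| ≤ κ := fun h k => hlip G h.1 k.1
  have hsym : ∀ h k, E h k = E k h := by
    intro h k
    have : G.addEdge h.1 k.1 = G.addEdge k.1 h.1 := by
      have h0 : ∀ i j : G.V, G.addEdge i j = G.addEdge j i := by
        intro i j
        simp only [Multigraph.addEdge, Sym2.eq_swap]
      exact h0 _ _
    simp only [hE, this]
  have hconcE := conc_half (fun i j : V => f (G.addEdge i j) - f G)
    (fun h : HalfEdge V d => h.1) (fun x hx => hconc G x hx)
  have hSp : 0 < S := by linarith
  have hTp : 0 < T := by linarith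
  have hS1 : 0 < S - 1 := by linarith
  have hT1 : 0 < T - 1 := by linarith
  have h2 := conc_two E hsym hconcE (freeH V d m A) (freeH V d m B) S T hS hT hSp hTp
  have hA : (∑ q ∈ newD V d m A A, E q.1 q.2) / (S * (S - 1))
      ≤ (∑ h ∈ freeH V d m A, ∑ k ∈ freeH V d m A, E h k) / (S * S) + 2 * κ / δ := by
    have := no_repl E κ hlipE (freeH V d m A) S δ hS hδ hSδ hκ0
    convert this using 3
    ext q
    simp [newD]
  have hB : (∑ q ∈ newD V d m B B, E q.1 q.2) / (T * (T - 1))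
      ≤ (∑ h ∈ freeH V d m B, ∑ k ∈ freeH V d m B, E h k) / (T * T) + 2 * κ / δ := by
    have := no_repl E κ hlipE (freeH V d m B) T δ hT hδ hTδ hκ0
    convert this using 3
    ext q
    simp [newD]
  rw [hsub, hsub, hsub, newD_card_same, newD_card_same, newD_cross hAB, Finset.card_product,
    Nat.cast_mul, hS, hT, add_div (c := S * (S - 1)), add_div (c := T * (T - 1)),
    add_div (c := S * T), mul_div_cancel_left₀ _ (by positivity : S * (S - 1) ≠ 0),
    mul_div_cancel_left₀ _ (by positivity : T * (T - 1) ≠ 0),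
    mul_div_cancel_left₀ _ (by positivity : S * T ≠ 0), Finset.sum_product]
  linarith

end helpers

theorem statement8 (f : Multigraph → ℝ) (κ : ℝ)
    (hinv : GraphParam.Invariant f) (hlip : GraphParam.Lipschitz f κ)
    (hconc : GraphParam.Concave f)
    (V : Type) [Fintype V] [DecidableEq V] (A B : Finset V)
    (hAB : Disjoint A B) (hUnion : A ∪ B = Finset.univ) (d : V → ℕ)
    (a b c δ : ℕ) (hδ : 2 ≤ δ) (hfeas : Feasible V d A B a b (c + δ)) :
    (Fav V d A B f (a + 1) b c + Fav V d A B f a (b + 1) c) / 2 ≤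
      Fav V d A B f a b (c + 1) + 2 * κ / (δ : ℝ) := by
  have hcard : ∀ m ∈ Mset V d A B a b c,
      (freeH V d m A).card = ∑ i ∈ A, d i - (2 * a + c) ∧
      (freeH V d m B).card = ∑ i ∈ B, d i - (2 * b + c) := by
    intro m hm
    obtain ⟨h1, h2, h3, h4⟩ := mem_Mset.1 hm
    have e1 := card_free h1 hAB hUnion
    have e2 := card_free h1 hAB.symm (by rw [Finset.union_comm]; exact hUnion)
    have hsw : ∀ p : Sym2 (HalfEdge V d), crossEnds B A p ↔ crossEnds A B p :=
      fun p => and_comm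
    simp only [hsw] at e2
    rw [h2, h4] at e1
    rw [h3, h4] at e2
    omega
  obtain ⟨hf1, hf2⟩ := hfeas
  obtain ⟨S, hS⟩ : ∃ S, S = ∑ i ∈ A, d i - (2 * a + c) := ⟨_, rfl⟩
  obtain ⟨T, hT⟩ : ∃ T, T = ∑ i ∈ B, d i - (2 * b + c) := ⟨_, rfl⟩
  rw [← hS, ← hT] at hcard
  have hSδ : δ ≤ S := by omega
  have hTδ : δ ≤ T := by omega
  have hκ0 : 0 ≤ κ := by
    have hne : A.Nonempty := by
      by_contra h
      rw [Finset.not_nonempty_iff_eq_empty] at h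
      subst h
      simp at hf1
      omega
    obtain ⟨i, _⟩ := hne
    exact (abs_nonneg _).trans (hlip { V := V, edges := 0 } i i)
  have hdis : ∀ i, i ∈ A → i ∉ B := fun i h => Finset.disjoint_left.1 hAB h
  have hdis' : ∀ i, i ∈ B → i ∉ A := fun i h h' => hdis i h' h
  have eA := Fav_eq (d := d) A B A A f a b c (a + 1) b c (2 * (a + 1))
    ((S : ℝ) * ((S : ℝ) - 1)) (by omega)
    (by
      intro h k hh hk
      simp [bothEnds_mk, crossEnds_mk, hh, hk, hdis _ hh, hdis _ hk])
    (by
      intro m hm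
      obtain ⟨h1, h2, h3, h4⟩ := mem_Mset.1 hm
      rw [darts_card_both h1, h2])
    (by
      intro m hm
      rw [newD_card_same, (hcard m hm).1])
  have eB := Fav_eq (d := d) A B B B f a b c a (b + 1) c (2 * (b + 1))
    ((T : ℝ) * ((T : ℝ) - 1)) (by omega)
    (by
      intro h k hh hk
      simp [bothEnds_mk, crossEnds_mk, hh, hk, hdis' _ hh, hdis' _ hk])
    (by
      intro m hm
      obtain ⟨h1, h2, h3, h4⟩ := mem_Mset.1 hm
      rw [darts_card_both h1, h3])
    (by
      intro m hm
      rw [newD_card_same, (hcard m hm).2])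
  have eC := Fav_eq (d := d) A B A B f a b c a b (c + 1) (c + 1)
    ((S : ℝ) * (T : ℝ)) (by omega)
    (by
      intro h k hh hk
      simp [bothEnds_mk, crossEnds_mk, hh, hk, hdis _ hh, hdis' _ hk])
    (by
      intro m hm
      obtain ⟨h1, h2, h3, h4⟩ := mem_Mset.1 hm
      rw [darts_card_cross m hAB, h4])
    (by
      intro m hm
      rw [newD_cross hAB, Finset.card_product, (hcard m hm).1, (hcard m hm).2, Nat.cast_mul])
  rw [eA, eB, eC]
  have hδ' : (2 : ℝ) ≤ δ := by exact_mod_cast hδ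
  rcases Finset.eq_empty_or_nonempty (Mset V d A B a b c) with he | hne
  · rw [he]
    simp
    positivity
  have hMp : (0 : ℝ) < (Mset V d A B a b c).card := by
    exact_mod_cast Finset.card_pos.2 hne
  have hsum := Finset.sum_le_sum fun m (hm : m ∈ Mset V d A B a b c) =>
    pointwise f κ hlip hconc A B hAB m (S : ℝ) (T : ℝ) (δ : ℝ) hδ'
      (by rw [(hcard m hm).1]) (by rw [(hcard m hm).2])
      (by exact_mod_cast hSδ) (by exact_mod_cast hTδ) hκ0
  rw [← Finset.sum_div, Finset.sum_add_distrib, Finset.sum_add_distrib, Finset.sum_const,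
    nsmul_eq_mul] at hsum
  rw [← add_div, div_right_comm, div_le_iff₀ hMp, add_mul, div_mul_cancel₀ _ hMp.ne']
  linarith
end
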